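/- arXiv:2404.11186 — 4 statements merged into one kernel-verified Lean document; each statement's English description precedes it below -/
import Mathlib

section
/- Let G be a finite non-nilpotent solvable group satisfying the MGSE property. Then G/Frat(G) is isomorphic to a semidirect product N^δ ⋊ H for some δ ≥ 1, where H is cyclic of prime order, N is an irreducible H-module, C_H(N) = 1, and H acts on the direct product N^δ of δ copies of N diagonally; that is, the group Q = G/Frat(G) has a complemented abelian normal subgroup V which is a direct product V = N_1 × ⋯ × N_δ of minimal normal subgroups of Q that are pairwise H-isomorphic, with complement H cyclic of prime order acting faithfully on each N_i. -/
/-- A subset `S` of a group is a minimal generating set if it generates the whole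
group but no proper subset obtained by removing one element does. -/
def IsMinimalGeneratingSet {G : Type*} [Group G] (S : Set G) : Prop :=
  Subgroup.closure S = ⊤ ∧ ∀ s ∈ S, Subgroup.closure (S \ {s}) ≠ ⊤

/-- `minGen G = d(G)` is the minimal size of a generating set of `G`. -/
noncomputable def minGen (G : Type*) [Group G] : ℕ :=
  sInf {n | ∃ S : Finset G, S.card = n ∧ Subgroup.closure (S : Set G) = ⊤}

/-- The minimal generating set exchange property (MGSE): whenever
`G = ⟨x_1,…,x_d⟩ = ⟨y_1,…,y_d⟩` with `d = d(G)`, for every `i` there exists `j`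
such that replacing `x_i` by `y_j` still yields a generating set. -/
def MGSE (G : Type*) [Group G] : Prop :=
  ∀ x y : Fin (minGen G) → G,
    Subgroup.closure (Set.range x) = ⊤ → Subgroup.closure (Set.range y) = ⊤ →
    ∀ i : Fin (minGen G), ∃ j : Fin (minGen G),
      Subgroup.closure (Set.range (Function.update x i (y j))) = ⊤

section Generation

variable {G M : Type*} [Group G] [Group M]

theorem minGen_le_of_closure_range {k : ℕ} {x : Fin k → G}
    (hx : Subgroup.closure (Set.range x) = ⊤) : minGen G ≤ k := by
  classical
  have h1 : minGen G ≤ (Finset.univ.image x).card := by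
    apply Nat.sInf_le
    exact ⟨Finset.univ.image x, rfl, by simpa using hx⟩
  exact h1.trans (Finset.card_image_le.trans (by simp))

theorem exists_closure_range_minGen (G : Type*) [Group G] [Finite G] :
    ∃ x : Fin (minGen G) → G, Subgroup.closure (Set.range x) = ⊤ := by
  classical
  have hne : {n | ∃ S : Finset G, S.card = n ∧ Subgroup.closure (S : Set G) = ⊤}.Nonempty := by
    have := Fintype.ofFinite G
    exact ⟨_, Finset.univ, rfl, by simp⟩
  obtain ⟨S, hS, hgen⟩ := Nat.sInf_mem hne
  let e : Fin (minGen G) ≃ S := (finCongr hS.symm).trans S.equivFin.symm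
  refine ⟨fun i => (e i : G), ?_⟩
  have : Set.range (fun i => (e i : G)) = (S : Set G) := by
    ext g
    constructor
    · rintro ⟨i, rfl⟩
      exact (e i).2
    · intro hg
      exact ⟨e.symm ⟨g, hg⟩, by simp⟩
  rw [this]
  exact hgen

theorem closure_eq_top_of_forall_mem {S T : Set G} (hS : Subgroup.closure S = ⊤)
    (h : ∀ g ∈ S, g ∈ Subgroup.closure T) : Subgroup.closure T = ⊤ :=
  top_le_iff.mp (hS ▸ (Subgroup.closure_le _).mpr h)

theorem closure_range_comp_eq_top {ι : Type*} {x : ι → G} {p : G →* M}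
    (hp : Function.Surjective p) (hx : Subgroup.closure (Set.range x) = ⊤) :
    Subgroup.closure (Set.range fun i => p (x i)) = ⊤ := by
  have : Set.range (fun i => p (x i)) = p '' Set.range x := (Set.range_comp p x)
  rw [this, ← MonoidHom.map_closure, hx, Subgroup.map_top_of_surjective p hp]

theorem minGen_le_of_surjective [Finite G] (p : G →* M) (hp : Function.Surjective p) :
    minGen M ≤ minGen G := by
  obtain ⟨x, hx⟩ := exists_closure_range_minGen G
  exact minGen_le_of_closure_range (closure_range_comp_eq_top hp hx)

/-- If the members of a generating tuple other than the `i`-th one already generate, the tuple is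
longer than `minGen G`. -/
theorem minGen_lt_of_closure_omit {k : ℕ} {x : Fin k → G} (i : Fin k)
    (hx : Subgroup.closure (x '' {j | j ≠ i}) = ⊤) : minGen G < k := by
  obtain _ | k := k
  · exact i.elim0
  · have : minGen G ≤ k := by
      apply minGen_le_of_closure_range (x := x ∘ i.succAbove)
      rw [Set.range_comp, Fin.range_succAbove]
      exact hx
    omega

theorem exists_zpowers_eq_top_of_minGen_le_one [Finite G] (h : minGen G ≤ 1) :
    ∃ a : G, Subgroup.zpowers a = ⊤ := by
  obtain ⟨x, hx⟩ := exists_closure_range_minGen G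
  have : Subsingleton (Fin (minGen G)) := Fin.subsingleton_iff_le_one.mpr h
  rcases isEmpty_or_nonempty (Fin (minGen G)) with hE | ⟨⟨i⟩⟩
  · refine ⟨1, top_le_iff.mp (hx ▸ (Subgroup.closure_le _).mpr ?_)⟩
    rintro _ ⟨j, rfl⟩
    exact hE.elim j
  · refine ⟨x i, top_le_iff.mp (hx ▸ (Subgroup.closure_le _).mpr ?_)⟩
    rintro _ ⟨j, rfl⟩
    rw [Subsingleton.elim j i]
    exact Subgroup.mem_zpowers _

theorem MGSE.exchange (h : MGSE G) {d : ℕ} (hd : minGen G = d) {x y : Fin d → G}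
    (hx : Subgroup.closure (Set.range x) = ⊤) (hy : Subgroup.closure (Set.range y) = ⊤)
    (i : Fin d) : ∃ j, Subgroup.closure (Set.range (Function.update x i (y j))) = ⊤ := by
  subst hd
  exact h x y hx hy i

end Generation

/-- `p : G →* M` is a surjection split by `e`, whose kernel is an abelian minimal normal
subgroup of `G`. -/
structure MinimalSplit {G M : Type*} [Group G] [Group M] (p : G →* M) (e : M →* G) : Prop where
  apply_section : ∀ m, p (e m) = m
  ker_comm : ∀ a ∈ p.ker, ∀ b ∈ p.ker, a * b = b * a
  ker_ne_bot : p.ker ≠ ⊥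
  ker_min : ∀ W : Subgroup G, W ≤ p.ker → W.Normal → W = ⊥ ∨ W = p.ker

namespace MinimalSplit

variable {G M : Type*} [Group G] [Group M] {p : G →* M} {e : M →* G}

theorem surjective (hs : MinimalSplit p e) : Function.Surjective p :=
  fun m => ⟨e m, hs.apply_section m⟩

theorem mul_inv_mem_ker (hs : MinimalSplit p e) (g : G) : g * (e (p g))⁻¹ ∈ p.ker := by
  rw [MonoidHom.mem_ker, map_mul, map_inv, hs.apply_section, mul_inv_cancel]

theorem exists_mem_ker_ne_one (hs : MinimalSplit p e) : ∃ n ∈ p.ker, n ≠ 1 := by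
  by_contra! h
  exact hs.ker_ne_bot ((Subgroup.eq_bot_iff_forall _).mpr h)

/-- A subgroup of the kernel normalized by the complement is trivial or the whole kernel. -/
theorem eq_bot_or_eq_ker (hs : MinimalSplit p e) {W : Subgroup G} (hW : W ≤ p.ker)
    (hconj : ∀ m, ∀ w ∈ W, e m * w * (e m)⁻¹ ∈ W) : W = ⊥ ∨ W = p.ker := by
  refine hs.ker_min W hW ⟨fun w hw g => ?_⟩
  have h1 := hs.mul_inv_mem_ker g
  have h2 := hconj (p g) w hw
  have h3 := hs.ker_comm _ h1 _ (hW h2)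
  have : g * w * g⁻¹ = e (p g) * w * (e (p g))⁻¹ := by
    calc g * w * g⁻¹ = (g * (e (p g))⁻¹) * (e (p g) * w * (e (p g))⁻¹) * (g * (e (p g))⁻¹)⁻¹ := by
          group
      _ = _ := by rw [h3, mul_inv_cancel_right]
  rwa [this]

/-- A proper supplement of the kernel is a complement. -/
theorem inf_ker_eq_bot (hs : MinimalSplit p e) {K : Subgroup G}
    (hK : K.map p = ⊤) (hne : K ≠ ⊤) : K ⊓ p.ker = ⊥ := by
  have key : ∀ g, ∃ k ∈ K, g * k⁻¹ ∈ p.ker := by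
    intro g
    have : p g ∈ K.map p := hK ▸ Subgroup.mem_top _
    obtain ⟨k, hk, hkg⟩ := this
    exact ⟨k, hk, by rw [MonoidHom.mem_ker, map_mul, map_inv, hkg, mul_inv_cancel]⟩
  have hnormal : (K ⊓ p.ker).Normal := by
    refine ⟨fun w hw g => ?_⟩
    obtain ⟨k, hk, hg⟩ := key g
    have h2 : k * w * k⁻¹ ∈ K ⊓ p.ker :=
      ⟨K.mul_mem (K.mul_mem hk hw.1) (K.inv_mem hk), p.normal_ker.conj_mem _ hw.2 _⟩
    have h3 := hs.ker_comm _ hg _ h2.2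
    have : g * w * g⁻¹ = k * w * k⁻¹ := by
      calc g * w * g⁻¹ = (g * k⁻¹) * (k * w * k⁻¹) * (g * k⁻¹)⁻¹ := by group
        _ = _ := by rw [h3, mul_inv_cancel_right]
    rwa [this]
  rcases hs.ker_min (K ⊓ p.ker) inf_le_right hnormal with h | h
  · exact h
  · exfalso
    apply hne
    rw [Subgroup.eq_top_iff']
    intro g
    obtain ⟨k, hk, hg⟩ := key g
    have : g * k⁻¹ ∈ K := (inf_eq_right.mp h) hg
    simpa using K.mul_mem this hk

/-- A complement of the kernel is the range of a section of `p`. -/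
theorem exists_section_of_complement {K : Subgroup G}
    (hK : K.map p = ⊤) (hinf : K ⊓ p.ker = ⊥) :
    ∃ s : M →* G, (∀ m, p (s m) = m) ∧ ∀ k ∈ K, s (p k) = k := by
  let q : K →* M := p.comp K.subtype
  have hinj : Function.Injective q := by
    rw [injective_iff_map_eq_one]
    intro k hk
    have : (k : G) ∈ K ⊓ p.ker := ⟨k.2, hk⟩
    rw [hinf, Subgroup.mem_bot] at this
    exact Subtype.ext this
  have hsurj : Function.Surjective q := by
    intro m
    have : m ∈ K.map p := hK ▸ Subgroup.mem_top m
    obtain ⟨k, hk, hkm⟩ := this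
    exact ⟨⟨k, hk⟩, hkm⟩
  let E := MulEquiv.ofBijective q ⟨hinj, hsurj⟩
  refine ⟨K.subtype.comp E.symm.toMonoidHom, fun m => E.apply_symm_apply m, fun k hk => ?_⟩
  have := E.symm_apply_apply ⟨k, hk⟩
  exact congrArg Subtype.val this

/-- A tuple that generates modulo the kernel but does not generate `G` lies on a section. -/
theorem exists_section (hs : MinimalSplit p e) {ι : Type*} {g : ι → G}
    (hg : Subgroup.closure (Set.range fun i => p (g i)) = ⊤)
    (hne : Subgroup.closure (Set.range g) ≠ ⊤) :
    ∃ s : M →* G, (∀ m, p (s m) = m) ∧ ∀ k ∈ Subgroup.closure (Set.range g), s (p k) = k := by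
  have hK : (Subgroup.closure (Set.range g)).map p = ⊤ := by
    rw [MonoidHom.map_closure, ← Set.range_comp]
    exact hg
  exact exists_section_of_complement hK (hs.inf_ker_eq_bot hK hne)

theorem closure_ne_top_of_section (hs : MinimalSplit p e) {ι : Type*} {g : ι → G} (s : M →* G)
    (hsec : ∀ m, p (s m) = m) (h : ∀ i, s (p (g i)) = g i) :
    Subgroup.closure (Set.range g) ≠ ⊤ := by
  intro htop
  obtain ⟨n, hn, hn1⟩ := hs.exists_mem_ker_ne_one
  have hle : Subgroup.closure (Set.range g) ≤ s.range := by
    rw [Subgroup.closure_le]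
    rintro _ ⟨i, rfl⟩
    exact ⟨_, h i⟩
  obtain ⟨m, rfl⟩ := hle (htop ▸ Subgroup.mem_top n)
  rw [MonoidHom.mem_ker, hsec] at hn
  exact hn1 (by rw [hn, map_one])

/-- Adding a nontrivial element of the kernel to a supplement of the kernel gives everything. -/
theorem closure_cons_eq_top (hs : MinimalSplit p e) {k : ℕ} {g : Fin k → G}
    (hg : Subgroup.closure (Set.range fun i => p (g i)) = ⊤) {n : G} (hn : n ∈ p.ker)
    (hn1 : n ≠ 1) :
    Subgroup.closure (Set.range (Fin.cons n g : Fin (k + 1) → G)) = ⊤ := by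
  by_contra hne
  have hK : (Subgroup.closure (Set.range (Fin.cons n g : Fin (k + 1) → G))).map p = ⊤ := by
    rw [MonoidHom.map_closure]
    refine closure_eq_top_of_forall_mem hg ?_
    rintro _ ⟨i, rfl⟩
    exact Subgroup.subset_closure ⟨g i, ⟨i.succ, by simp⟩, rfl⟩
  have h := hs.inf_ker_eq_bot hK hne
  have : n ∈ (⊥ : Subgroup G) := by
    rw [← h]
    exact ⟨Subgroup.subset_closure ⟨0, by simp⟩, hn⟩
  exact hn1 (by simpa using this)

theorem minGen_le_succ (hs : MinimalSplit p e) [Finite M] : minGen G ≤ minGen M + 1 := by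
  obtain ⟨x, hx⟩ := exists_closure_range_minGen M
  obtain ⟨n, hn, hn1⟩ := hs.exists_mem_ker_ne_one
  exact minGen_le_of_closure_range
    (hs.closure_cons_eq_top (g := fun i => e (x i)) (by simpa [hs.apply_section] using hx) hn hn1)

/-- The sections of `p` form a heap. -/
theorem exists_heap_section (hs : MinimalSplit p e) (r q t : M →* G) (hr : ∀ m, p (r m) = m)
    (hq : ∀ m, p (q m) = m) (ht : ∀ m, p (t m) = m) :
    ∃ s : M →* G, (∀ m, p (s m) = m) ∧ ∀ m, s m = r m * (q m)⁻¹ * t m := by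
  refine ⟨MonoidHom.mk' (fun m => r m * (q m)⁻¹ * t m) fun a b => ?_, fun m => ?_, fun m => rfl⟩
  · have h1 : r b * (q b)⁻¹ ∈ p.ker := by simp [MonoidHom.mem_ker, hr, hq]
    have h2 : (q a)⁻¹ * t a ∈ p.ker := by simp [MonoidHom.mem_ker, ht, hq]
    have h3 := hs.ker_comm _ h1 _ h2
    simp only [map_mul, mul_inv_rev]
    calc r a * r b * ((q b)⁻¹ * (q a)⁻¹) * (t a * t b)
        = r a * ((r b * (q b)⁻¹) * ((q a)⁻¹ * t a)) * t b := by group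
      _ = _ := by rw [h3]; group
  · simp [hr, hq, ht]

end MinimalSplit

namespace MinimalSplit

variable {G M : Type*} [Group G] [Group M] {p : G →* M} {e : M →* G}

/-- If every coordinate of a tuple can be individually lifted by a section, then the tuple lies on
a section. -/
theorem exists_section_of_forall_single (hs : MinimalSplit p e) {ι : Type*} [Finite ι] (g : ι → G)
    (h : ∀ i, ∃ s : M →* G, (∀ m, p (s m) = m) ∧ s (p (g i)) = g i ∧
      ∀ j ≠ i, s (p (g j)) = e (p (g j))) :
    ∃ s : M →* G, (∀ m, p (s m) = m) ∧ ∀ i, s (p (g i)) = g i := by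
  classical
  have := Fintype.ofFinite ι
  suffices H : ∀ S : Finset ι, ∃ s : M →* G, (∀ m, p (s m) = m) ∧
      (∀ i ∈ S, s (p (g i)) = g i) ∧ ∀ i ∉ S, s (p (g i)) = e (p (g i)) by
    obtain ⟨s, hsec, h1, -⟩ := H Finset.univ
    exact ⟨s, hsec, fun i => h1 i (Finset.mem_univ i)⟩
  intro S
  induction S using Finset.induction_on with
  | empty => exact ⟨e, hs.apply_section, by simp, by simp⟩
  | insert k S hk ih =>
    obtain ⟨s, hsec, h1, h2⟩ := ih
    obtain ⟨t, htsec, ht1, ht2⟩ := h k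
    obtain ⟨u, husec, hu⟩ := hs.exists_heap_section s e t hsec hs.apply_section htsec
    refine ⟨u, husec, fun i hi => ?_, fun i hi => ?_⟩
    · rw [hu]
      rcases Finset.mem_insert.mp hi with rfl | hi
      · rw [ht1, h2 _ hk, mul_inv_cancel, one_mul]
      · rw [h1 _ hi, ht2 i (fun h => hk (h ▸ hi)), inv_mul_cancel_right]
    · rw [Finset.mem_insert, not_or] at hi
      rw [hu, h2 _ hi.2, ht2 _ hi.1, mul_inv_cancel, one_mul]

/-- If `M` needs as many generators as `G`, the exchange property forces that either the `i`-th
coordinate or all the other coordinates of a tuple can be lifted freely. -/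
theorem single_or_rest (hs : MinimalSplit p e) (hG : MGSE G) {d : ℕ} (hd : minGen G = d)
    (hM : minGen M = d) {g : Fin d → G} (hg : Subgroup.closure (Set.range g) = ⊤) (i : Fin d) :
    (∃ s : M →* G, (∀ m, p (s m) = m) ∧ s (p (g i)) = g i ∧
      ∀ j ≠ i, s (p (g j)) = e (p (g j))) ∨
    ∀ c : Fin d → G, (∀ j, p (c j) = p (g j)) →
      ∃ s : M →* G, (∀ m, p (s m) = m) ∧ s (p (g i)) = e (p (g i)) ∧
        ∀ j ≠ i, s (p (g j)) = c j := by
  have hx := closure_range_comp_eq_top hs.surjective hg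
  by_contra! hcon
  obtain ⟨h1, c, hc, h2⟩ := hcon
  set u : Fin d → G := Function.update (fun j => e (p (g j))) i (g i) with hu
  set v : Fin d → G := Function.update c i (e (p (g i))) with hv
  have hpu : ∀ j, p (u j) = p (g j) := by
    intro j
    rcases eq_or_ne j i with rfl | hj
    · simp [hu]
    · simp [hu, hj, hs.apply_section]
  have hpv : ∀ j, p (v j) = p (g j) := by
    intro j
    rcases eq_or_ne j i with rfl | hj
    · simp [hv, hs.apply_section]
    · simp [hv, hj, hc]
  have hutop : Subgroup.closure (Set.range u) = ⊤ := by
    by_contra hne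
    obtain ⟨s, hsec, hsk⟩ := hs.exists_section (by simpa only [hpu] using hx) hne
    have hsu : ∀ j, s (p (g j)) = u j := fun j => by
      rw [← hpu, hsk _ (Subgroup.subset_closure ⟨j, rfl⟩)]
    obtain ⟨j, hj, hj'⟩ := h1 s hsec (by rw [hsu, hu, Function.update_self])
    exact hj' (by rw [hsu, hu, Function.update_of_ne hj])
  have hvtop : Subgroup.closure (Set.range v) = ⊤ := by
    by_contra hne
    obtain ⟨s, hsec, hsk⟩ := hs.exists_section (by simpa only [hpv] using hx) hne
    have hsv : ∀ j, s (p (g j)) = v j := fun j => by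
      rw [← hpv, hsk _ (Subgroup.subset_closure ⟨j, rfl⟩)]
    obtain ⟨j, hj, hj'⟩ := h2 s hsec (by rw [hsv, hv, Function.update_self])
    exact hj' (by rw [hsv, hv, Function.update_of_ne hj])
  obtain ⟨j, hj⟩ := hG.exchange hd hutop hvtop i
  rcases eq_or_ne j i with rfl | hji
  · refine hs.closure_ne_top_of_section e hs.apply_section (fun k => ?_) hj
    rcases eq_or_ne k j with rfl | hk
    · simp [hv, hs.apply_section]
    · simp [hu, hk, hs.apply_section]
  · have h3 := closure_range_comp_eq_top hs.surjective hj
    have h4 : Subgroup.closure ((fun k => p (g k)) '' {k | k ≠ i}) = ⊤ := by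
      refine closure_eq_top_of_forall_mem h3 ?_
      rintro _ ⟨k, rfl⟩
      rcases eq_or_ne k i with rfl | hk
      · exact Subgroup.subset_closure ⟨j, hji, by simp [hpv]⟩
      · exact Subgroup.subset_closure ⟨k, hk, by simp [hk, hpu]⟩
    exact absurd (minGen_lt_of_closure_omit i h4) (by omega)

/-- In a group with the exchange property needing at least two generators, factoring out a
complemented abelian minimal normal subgroup lowers the number of generators. -/
theorem minGen_eq_succ [Finite G] (hs : MinimalSplit p e) (hG : MGSE G) (h2 : 2 ≤ minGen G) :
    minGen G = minGen M + 1 := by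
  have : Finite M := Finite.of_surjective p hs.surjective
  by_contra hne
  have hM : minGen M = minGen G := by
    have h3 := hs.minGen_le_succ
    have h4 := minGen_le_of_surjective p hs.surjective
    omega
  have exists_rest : ∀ g : Fin (minGen G) → G, Subgroup.closure (Set.range g) = ⊤ → ∃ i,
      ∀ c : Fin (minGen G) → G, (∀ j, p (c j) = p (g j)) →
      ∃ s : M →* G, (∀ m, p (s m) = m) ∧ s (p (g i)) = e (p (g i)) ∧
        ∀ j ≠ i, s (p (g j)) = c j := by
    intro g hg
    by_contra! hcon
    obtain ⟨s, hsec, hsg⟩ := hs.exists_section_of_forall_single g fun i =>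
      (hs.single_or_rest hG rfl hM hg i).resolve_right (by push Not; exact hcon i)
    exact hs.closure_ne_top_of_section s hsec hsg hg
  obtain ⟨g, hg⟩ := exists_closure_range_minGen G
  obtain ⟨i, hi⟩ := exists_rest g hg
  have : Nontrivial (Fin (minGen G)) := Fin.nontrivial_iff_two_le.mpr h2
  obtain ⟨j, hji⟩ := exists_ne i
  set g' : Fin (minGen G) → G := Function.update g i (g i * g j) with hg'def
  have hg' : Subgroup.closure (Set.range g') = ⊤ := by
    refine closure_eq_top_of_forall_mem hg ?_
    have hmem : ∀ k, g' k ∈ Subgroup.closure (Set.range g') :=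
      fun k => Subgroup.subset_closure ⟨k, rfl⟩
    have hmem' : ∀ k ≠ i, g k ∈ Subgroup.closure (Set.range g') := by
      intro k hk
      simpa [hg'def, hk] using hmem k
    rintro _ ⟨k, rfl⟩
    rcases eq_or_ne k i with rfl | hk
    · have h5 := hmem k
      rw [hg'def, Function.update_self] at h5
      exact ((Subgroup.closure (Set.range g')).mul_mem_cancel_right (hmem' j hji)).mp h5
    · exact hmem' k hk
  obtain ⟨k, hk⟩ := exists_rest g' hg'
  obtain ⟨r, hrsec, hrk⟩ : ∃ r : M →* G, (∀ m, p (r m) = m) ∧ r (p (g' k)) = g' k := by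
    rcases eq_or_ne k i with rfl | hki
    · obtain ⟨r, hrsec, hr1, hr2⟩ := hi
        (Function.update g j ((e (p (g k)))⁻¹ * (g k * g j))) (by
          intro l
          rcases eq_or_ne l j with rfl | hl
          · simp [hs.apply_section]
          · simp [hl])
      refine ⟨r, hrsec, ?_⟩
      rw [hg'def, Function.update_self, map_mul, map_mul, hr1, hr2 j hji, Function.update_self,
        mul_inv_cancel_left]
    · obtain ⟨r, hrsec, -, hr2⟩ := hi g fun _ => rfl
      refine ⟨r, hrsec, ?_⟩
      rw [hg'def, Function.update_of_ne hki, hr2 k hki]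
  obtain ⟨q, hqsec, hq1, hq2⟩ := hk (fun l => r (p (g' l))) fun l => hrsec _
  obtain ⟨t, htsec, ht1, ht2⟩ := hk g' fun _ => rfl
  obtain ⟨s, hsec, hseq⟩ := hs.exists_heap_section r q t hrsec hqsec htsec
  refine hs.closure_ne_top_of_section s hsec (fun l => ?_) hg'
  rw [hseq]
  rcases eq_or_ne l k with rfl | hl
  · rw [hrk, hq1, ht1, inv_mul_cancel_right]
  · rw [hq2 l hl, ht2 l hl, mul_inv_cancel, one_mul]

/-- The exchange property passes to `M` when `M` needs fewer generators. -/
theorem mgse_of_minGen_eq_succ (hs : MinimalSplit p e) (hG : MGSE G)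
    (hd : minGen G = minGen M + 1) : MGSE M := by
  intro x y hx hy i
  obtain ⟨n, hn, hn1⟩ := hs.exists_mem_ker_ne_one
  have hx' := hs.closure_cons_eq_top (g := fun i => e (x i))
    (by simpa [hs.apply_section] using hx) hn hn1
  have hy' := hs.closure_cons_eq_top (g := fun i => e (y i))
    (by simpa [hs.apply_section] using hy) hn hn1
  obtain ⟨j, hj⟩ := hG.exchange hd hx' hy' i.succ
  have h3 := closure_range_comp_eq_top hs.surjective hj
  have hn' : p n = 1 := hn
  induction j using Fin.cases with
  | zero =>
    refine ⟨i, closure_eq_top_of_forall_mem h3 ?_⟩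
    rintro _ ⟨k, rfl⟩
    induction k using Fin.cases with
    | zero => simp [(Fin.succ_ne_zero i).symm, hn']
    | succ k =>
      rcases eq_or_ne k i with rfl | hk
      · simp [hn']
      · exact Subgroup.subset_closure ⟨k, by simp [hk, hs.apply_section]⟩
  | succ j =>
    refine ⟨j, closure_eq_top_of_forall_mem h3 ?_⟩
    rintro _ ⟨k, rfl⟩
    induction k using Fin.cases with
    | zero => simp [(Fin.succ_ne_zero i).symm, hn']
    | succ k =>
      rcases eq_or_ne k i with rfl | hk
      · exact Subgroup.subset_closure ⟨k, by simp [hs.apply_section]⟩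
      · exact Subgroup.subset_closure ⟨k, by simp [hk, hs.apply_section]⟩

end MinimalSplit

namespace MinimalSplit

variable {G M : Type*} [Group G] [Group M] {p : G →* M} {e : M →* G}

/-- A tuple too short to generate `G` that generates modulo the kernel lies on a section. -/
theorem exists_section_of_lt (hs : MinimalSplit p e) {k : ℕ} (hk : k < minGen G) {x : Fin k → M}
    (hx : Subgroup.closure (Set.range x) = ⊤) (g : Fin k → G) (hg : ∀ i, p (g i) = x i) :
    ∃ s : M →* G, (∀ m, p (s m) = m) ∧ ∀ i, s (x i) = g i := by
  obtain ⟨s, hsec, h⟩ := hs.exists_section (g := g) (by simpa only [hg] using hx)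
    fun htop => absurd (minGen_le_of_closure_range htop) (by omega)
  exact ⟨s, hsec, fun i => by rw [← hg, h _ (Subgroup.subset_closure ⟨i, rfl⟩)]⟩

/-- The section of `p` obtained by conjugating `e` by an element of the kernel. -/
theorem exists_conj_section (hs : MinimalSplit p e) {n : G} (hn : n ∈ p.ker) :
    ∃ t : M →* G, (∀ m, p (t m) = m) ∧ ∀ m, t m = n * e m * n⁻¹ := by
  have hn' : p n = 1 := hn
  refine ⟨(MulAut.conj n).toMonoidHom.comp e, fun m => ?_, fun m => by simp⟩
  simp [hn', hs.apply_section]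

theorem section_apply_frattini [Finite M] (hs : MinimalSplit p e) (hG : MGSE G)
    (hd : minGen G = minGen M + 1) {x : Fin (minGen M) → M}
    (hx : Subgroup.closure (Set.range x) = ⊤) (i : Fin (minGen M)) {n : G} (hn : n ∈ p.ker)
    {s : M →* G} (hsi : s (x i) = e (x i))
    (hsj : ∀ j ≠ i, s (x j) = n * e (x j) * n⁻¹) {f : M} (hf : f ∈ frattini M) :
    s f = n * e f * n⁻¹ := by
  obtain ⟨t, htsec, ht⟩ := hs.exists_conj_section hn
  have hn' : p n = 1 := hn
  set u : Fin (minGen M) → G := fun j => s (x j) with hu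
  have hpu : ∀ j, p (u j) = x j := by
    intro j
    rcases eq_or_ne j i with rfl | hj
    · simp [hu, hsi, hs.apply_section]
    · simp [hu, hsj j hj, hs.apply_section, hn']
  set w : Fin (minGen M + 1) → G := Fin.cons (t f) u with hw
  have hpw : Subgroup.closure (Set.range fun j => p (w j)) = ⊤ := by
    refine closure_eq_top_of_forall_mem hx ?_
    rintro _ ⟨j, rfl⟩
    exact Subgroup.subset_closure ⟨j.succ, by simp [hw, hpu]⟩
  have hne : Subgroup.closure (Set.range w) ≠ ⊤ := by
    intro htop
    obtain ⟨n', hn'', hn1⟩ := hs.exists_mem_ker_ne_one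
    have hp' : p n' = 1 := hn''
    have hy := hs.closure_cons_eq_top (g := fun j => t (x j)) (by simpa [htsec] using hx) hn'' hn1
    obtain ⟨j, hj⟩ := hG.exchange hd htop hy i.succ
    induction j using Fin.cases with
    | zero =>
      have h3 := closure_range_comp_eq_top hs.surjective hj
      have h4 : Subgroup.closure (x '' {k | k ≠ i}) ⊔ frattini M = ⊤ := by
        rw [← top_le_iff, ← h3, Subgroup.closure_le]
        rintro _ ⟨k, rfl⟩
        induction k using Fin.cases with
        | zero =>
          refine Subgroup.mem_sup_right ?_
          simpa [(Fin.succ_ne_zero i).symm, hw, htsec] using hf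
        | succ k =>
          rcases eq_or_ne k i with rfl | hk
          · simp [hp']
          · refine Subgroup.mem_sup_left (Subgroup.subset_closure ⟨k, hk, ?_⟩)
            simp [hk, hw, hpu]
      exact lt_irrefl _ (minGen_lt_of_closure_omit i (frattini_nongenerating h4))
    | succ j =>
      refine hs.closure_ne_top_of_section t htsec (fun k => ?_) hj
      induction k using Fin.cases with
      | zero => simp [(Fin.succ_ne_zero i).symm, hw, htsec]
      | succ k =>
        rcases eq_or_ne k i with rfl | hk
        · simp [htsec]
        · simp [hk, hw, hu, hsj k hk, hs.apply_section, hn', ht]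
  obtain ⟨r, hrsec, hr⟩ := hs.exists_section hpw hne
  have hrs : r = s := by
    refine MonoidHom.eq_of_eqOn_dense hx ?_
    rintro _ ⟨j, rfl⟩
    have := hr (w j.succ) (Subgroup.subset_closure ⟨_, rfl⟩)
    simpa [hw, hpu] using this
  have := hr (w 0) (Subgroup.subset_closure ⟨_, rfl⟩)
  rw [← hrs, ← ht]
  simpa [hw, htsec] using this

/-- If the image of `frattini M` centralizes the kernel, it lies in `frattini G`. -/
theorem map_frattini_le [Finite M] (hs : MinimalSplit p e)
    (h : ∀ f ∈ frattini M, ∀ n ∈ p.ker, n * e f = e f * n) :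
    (frattini M).map e ≤ frattini G := by
  have hnormal : ((frattini M).map e).Normal := by
    refine ⟨?_⟩
    rintro _ ⟨f, hf, rfl⟩ g
    have hf' : p g * f * (p g)⁻¹ ∈ frattini M :=
      Subgroup.Normal.conj_mem inferInstance f hf (p g)
    have h1 := h _ hf' _ (hs.mul_inv_mem_ker g)
    refine ⟨_, hf', ?_⟩
    calc e (p g * f * (p g)⁻¹)
        = (g * (e (p g))⁻¹) * e (p g * f * (p g)⁻¹) * (g * (e (p g))⁻¹)⁻¹ := by
          rw [h1, mul_inv_cancel_right]
      _ = _ := by simp only [map_mul, map_inv]; group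
  refine le_iInf₂ fun L hL => ?_
  by_contra hle
  have htop : L ⊔ (frattini M).map e = ⊤ := by
    refine hL.2 _ (lt_of_le_of_ne le_sup_left fun heq => hle ?_)
    rw [heq]
    exact le_sup_right
  have h1 : L.comap e ⊔ frattini M = ⊤ := by
    rw [Subgroup.eq_top_iff']
    intro m
    have hm : e m ∈ L ⊔ (frattini M).map e := htop ▸ Subgroup.mem_top _
    obtain ⟨l, hl, _, ⟨f, hf, rfl⟩, hlf⟩ := Subgroup.mem_sup_of_normal_right.mp hm
    have h2 : m * f⁻¹ ∈ L.comap e := by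
      rw [Subgroup.mem_comap, map_mul, map_inv, ← hlf, mul_inv_cancel_right]
      exact hl
    simpa using Subgroup.mul_mem_sup h2 hf
  have h2 := frattini_nongenerating h1
  apply hle
  rintro _ ⟨f, -, rfl⟩
  have : f ∈ L.comap e := h2 ▸ Subgroup.mem_top f
  exact this

theorem frattini_eq_bot [Finite G] (hs : MinimalSplit p e) (hG : MGSE G)
    (hd : minGen G = minGen M + 1) (hF : frattini G = ⊥) : frattini M = ⊥ := by
  have : Finite M := Finite.of_surjective p hs.surjective
  obtain ⟨x, hx⟩ := exists_closure_range_minGen M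
  have key : ∀ i, ∀ n ∈ p.ker, ∀ f ∈ frattini M,
      ((e (x i))⁻¹ * n⁻¹ * e (x i) * n) * e f = e f * ((e (x i))⁻¹ * n⁻¹ * e (x i) * n) := by
    intro i n hn f hf
    have hn' : p n = 1 := hn
    obtain ⟨s, -, hsx⟩ := hs.exists_section_of_lt (by omega) hx
      (Function.update (fun j => n * e (x j) * n⁻¹) i (e (x i))) (by
        intro j
        rcases eq_or_ne j i with rfl | hj
        · simp [hs.apply_section]
        · simp [hj, hs.apply_section, hn'])
    have hsi : s (x i) = e (x i) := by rw [hsx, Function.update_self]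
    have hsj : ∀ j ≠ i, s (x j) = n * e (x j) * n⁻¹ := fun j hj => by
      rw [hsx, Function.update_of_ne hj]
    have h1 := hs.section_apply_frattini hG hd hx i hn hsi hsj hf
    have h2 := hs.section_apply_frattini hG hd hx i hn hsi hsj
      (Subgroup.Normal.conj_mem inferInstance f hf (x i))
    rw [map_mul, map_mul, map_inv, h1, hsi, map_mul, map_mul, map_inv] at h2
    have h3 := congrArg (fun g => (e (x i))⁻¹ * n⁻¹ * g * (n * e (x i))) h2
    calc ((e (x i))⁻¹ * n⁻¹ * e (x i) * n) * e f
        = ((e (x i))⁻¹ * n⁻¹ * (e (x i) * (n * e f * n⁻¹) * (e (x i))⁻¹) * (n * e (x i)))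
          * ((e (x i))⁻¹ * n⁻¹ * e (x i) * n) := by group
      _ = _ := by rw [h3]; group
  obtain ⟨W, hW⟩ : ∃ W : Subgroup G, ∀ n, n ∈ W ↔
      n ∈ p.ker ∧ ∀ f ∈ frattini M, n * e f = e f * n := by
    refine ⟨p.ker ⊓ Subgroup.centralizer ((frattini M).map e : Set G), fun n => ?_⟩
    rw [Subgroup.mem_inf, Subgroup.mem_centralizer_iff]
    refine and_congr_right fun _ => ⟨fun h f hf => (h _ ⟨f, hf, rfl⟩).symm, ?_⟩
    rintro h _ ⟨f, hf, rfl⟩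
    exact (h f hf).symm
  have hWconj : ∀ m, ∀ w ∈ W, e m * w * (e m)⁻¹ ∈ W := by
    intro m w hw
    rw [hW] at hw ⊢
    refine ⟨p.normal_ker.conj_mem _ hw.1 _, fun f hf => ?_⟩
    have h1 := hw.2 (m⁻¹ * f * m) (by
      simpa using Subgroup.Normal.conj_mem (inferInstance : (frattini M).Normal) f hf m⁻¹)
    simp only [map_mul, map_inv] at h1
    calc e m * w * (e m)⁻¹ * e f = e m * (w * ((e m)⁻¹ * e f * e m)) * (e m)⁻¹ := by group
      _ = _ := by rw [h1]; group
  have hWle : W ≤ p.ker := fun n hn => ((hW n).mp hn).1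
  have hle := hs.map_frattini_le fun f hf n hn => by
    have hWker : W = p.ker := by
      refine (hs.eq_bot_or_eq_ker hWle hWconj).resolve_left fun hbot => ?_
      have hcent : ∀ n ∈ p.ker, ∀ m, n * e m = e m * n := by
        intro n hn
        have hgen : ∀ i, n * e (x i) = e (x i) * n := by
          intro i
          have hmem : (e (x i))⁻¹ * n⁻¹ * e (x i) * n ∈ W := by
            refine (hW _).mpr ⟨p.ker.mul_mem ?_ hn, key i n hn⟩
            simpa using p.normal_ker.conj_mem _ (p.ker.inv_mem hn) (e (x i))⁻¹
          rw [hbot, Subgroup.mem_bot] at hmem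
          calc n * e (x i) = n * e (x i) * ((e (x i))⁻¹ * n⁻¹ * e (x i) * n) := by
                rw [hmem, mul_one]
            _ = _ := by group
        have hle : Subgroup.closure (Set.range x) ≤ (Subgroup.centralizer {n}).comap e := by
          rw [Subgroup.closure_le]
          rintro _ ⟨i, rfl⟩
          simpa [Subgroup.mem_centralizer_singleton_iff] using (hgen i).symm
        intro m
        have hm := hle (hx ▸ Subgroup.mem_top m)
        rw [Subgroup.mem_comap, Subgroup.mem_centralizer_singleton_iff] at hm
        exact hm.symm
      refine hs.ker_ne_bot (le_bot_iff.mp fun n hn => ?_)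
      rw [← hbot]
      exact (hW n).mpr ⟨hn, fun f _ => hcent n hn f⟩
    exact ((hW n).mp (hWker ▸ hn)).2 f hf
  rw [hF, le_bot_iff] at hle
  refine (Subgroup.eq_bot_iff_forall _).mpr fun f hf => ?_
  have h1 : e f ∈ (⊥ : Subgroup G) := hle ▸ Subgroup.mem_map_of_mem e hf
  rw [Subgroup.mem_bot] at h1
  rw [← hs.apply_section f, h1, map_one]

end MinimalSplit

namespace MinimalSplit

variable {G M : Type*} [Group G] [Group M] {p : G →* M} {e : M →* G}

/-- If `G` is generated by two elements and `M` by one, then in any generating pair of `M` one of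
the elements generates `M`. -/
theorem zpowers_eq_top_or (hs : MinimalSplit p e) [Finite G] (hG : MGSE G)
    (hd : minGen G = 2) {a : M} (ha : Subgroup.zpowers a = ⊤) {b c : M}
    (hbc : Subgroup.zpowers b ⊔ Subgroup.zpowers c = ⊤) :
    Subgroup.zpowers b = ⊤ ∨ Subgroup.zpowers c = ⊤ := by
  by_contra! hcon
  obtain ⟨hb, hc⟩ := hcon
  obtain ⟨n, hn, hn1⟩ := hs.exists_mem_ker_ne_one
  have hp : p n = 1 := hn
  have hsec : ∀ k : p.ker × p.ker, ∃ s : M →* G, (∀ m, p (s m) = m) ∧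
      s b = k.1 * e b ∧ s c = k.2 * e c := by
    rintro ⟨⟨k, hk⟩, ⟨l, hl⟩⟩
    have hpk : p k = 1 := hk
    have hpl : p l = 1 := hl
    have hgen : Subgroup.closure (Set.range fun i => p (![k * e b, l * e c] i)) = ⊤ := by
      rw [← top_le_iff, ← hbc, sup_le_iff, Subgroup.zpowers_le, Subgroup.zpowers_le]
      exact ⟨Subgroup.subset_closure ⟨0, by simp [hpk, hs.apply_section]⟩,
        Subgroup.subset_closure ⟨1, by simp [hpl, hs.apply_section]⟩⟩
    have hne : Subgroup.closure (Set.range ![k * e b, l * e c]) ≠ ⊤ := by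
      intro htop
      have ha' : Subgroup.closure (Set.range fun i => p ((![e a] : Fin 1 → G) i)) = ⊤ := by
        rw [← top_le_iff, ← ha, Subgroup.zpowers_le]
        exact Subgroup.subset_closure ⟨0, by simp [hs.apply_section]⟩
      have hx := hs.closure_cons_eq_top ha' hn hn1
      obtain ⟨j, hj⟩ := hG.exchange hd hx htop 1
      have h3 := closure_range_comp_eq_top hs.surjective hj
      have h4 : Subgroup.zpowers (p (![k * e b, l * e c] j)) = ⊤ := by
        rw [← top_le_iff, ← h3, Subgroup.closure_le]
        rintro _ ⟨i, rfl⟩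
        fin_cases i
        · simp [hp]
        · simp
      fin_cases j
      · exact hb (by simpa [hpk, hs.apply_section] using h4)
      · exact hc (by simpa [hpl, hs.apply_section] using h4)
    obtain ⟨s, hsec, h⟩ := hs.exists_section hgen hne
    refine ⟨s, hsec, ?_, ?_⟩
    · simpa [hpk, hs.apply_section] using h (k * e b) (Subgroup.subset_closure ⟨0, by simp⟩)
    · simpa [hpl, hs.apply_section] using h (l * e c) (Subgroup.subset_closure ⟨1, by simp⟩)
  choose s hs1 hs2 hs3 using hsec
  have hmem : ∀ k, s k a * (e a)⁻¹ ∈ p.ker := fun k => by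
    simp [MonoidHom.mem_ker, hs1, hs.apply_section]
  have hinj : Function.Injective fun k => (⟨s k a * (e a)⁻¹, hmem k⟩ : p.ker) := by
    intro k l hkl
    have h1 : s k a = s l a := mul_right_cancel (Subtype.ext_iff.mp hkl)
    have h2 : s k = s l := by
      refine MonoidHom.eq_of_eqOn_dense (s := {a})
        (by rw [← Subgroup.zpowers_eq_closure]; exact ha) ?_
      rintro _ rfl
      exact h1
    refine Prod.ext (Subtype.ext ?_) (Subtype.ext ?_)
    · exact mul_right_cancel ((hs2 k).symm.trans (h2 ▸ hs2 l))
    · exact mul_right_cancel ((hs3 k).symm.trans (h2 ▸ hs3 l))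
  have hcard := Nat.card_le_card_of_injective _ hinj
  rw [Nat.card_prod] at hcard
  have : 1 < Nat.card p.ker := (Subgroup.one_lt_card_iff_ne_bot _).mpr hs.ker_ne_bot
  nlinarith

theorem card_prime_of_minGen_eq_one (hs : MinimalSplit p e) [Finite G] (hG : MGSE G)
    (hd : minGen G = 2) (hM : minGen M = 1) (hF : frattini M = ⊥) : (Nat.card M).Prime := by
  have : Finite M := Finite.of_surjective p hs.surjective
  obtain ⟨a, ha⟩ := exists_zpowers_eq_top_of_minGen_le_one hM.le
  have : IsCyclic M := isCyclic_iff_exists_zpowers_eq_top.mpr ⟨a, ha⟩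
  have hnontriv : Nontrivial M := by
    by_contra hcon
    rw [not_nontrivial_iff_subsingleton] at hcon
    have : minGen M ≤ 0 := minGen_le_of_closure_range (x := Fin.elim0)
      (Subgroup.eq_top_iff' _ |>.mpr fun m => Subsingleton.elim 1 m ▸ Subgroup.one_mem _)
    omega
  have huniq : ∀ A B : Subgroup M, IsCoatom A → IsCoatom B → A = B := by
    intro A B hA hB
    by_contra hne
    obtain ⟨b, rfl⟩ := (Subgroup.isCyclic_iff_exists_zpowers_eq_top A).mp inferInstance
    obtain ⟨c, rfl⟩ := (Subgroup.isCyclic_iff_exists_zpowers_eq_top B).mp inferInstance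
    rcases hs.zpowers_eq_top_or hG hd ha (hA.sup_eq_top_of_ne hB hne) with h | h
    · exact hA.1 h
    · exact hB.1 h
  obtain ⟨A, hA, -⟩ := (eq_top_or_exists_le_coatom (⊥ : Subgroup M)).resolve_left bot_ne_top
  have hbot : IsCoatom (⊥ : Subgroup M) := by
    have : A ≤ frattini M := le_iInf₂ fun B hB => (huniq A B hA hB).le
    rw [hF, le_bot_iff] at this
    exact this ▸ hA
  obtain ⟨q, hq, hdvd⟩ := Nat.exists_prime_and_dvd (Finite.one_lt_card (α := M)).ne'
  have := Fact.mk hq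
  obtain ⟨z, hz⟩ := exists_prime_orderOf_dvd_card' q hdvd
  have hztop : Subgroup.zpowers z = ⊤ := by
    refine hbot.2 _ (bot_lt_iff_ne_bot.mpr fun h => ?_)
    rw [Subgroup.zpowers_eq_bot] at h
    rw [h, orderOf_one] at hz
    exact hq.one_lt.ne hz
  rw [← Subgroup.card_top, ← hztop, Nat.card_zpowers, hz]
  exact hq

end MinimalSplit

/-- `A` and `B` are `H`-isomorphic subgroups, for the conjugation action of `H`. -/
def ConjIso {G : Type*} [Group G] (H A B : Subgroup G) : Prop :=
  ∃ φ : G → G, Set.BijOn φ A B ∧ (∀ a ∈ A, ∀ b ∈ A, φ (a * b) = φ a * φ b) ∧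
    ∀ h ∈ H, ∀ n ∈ A, φ (h * n * h⁻¹) = h * φ n * h⁻¹

namespace ConjIso

variable {G M : Type*} [Group G] [Group M] {H A B C : Subgroup G}

theorem refl (H A : Subgroup G) : ConjIso H A A :=
  ⟨id, Set.bijOn_id _, fun _ _ _ _ => rfl, fun _ _ _ _ => rfl⟩

theorem trans (h₁ : ConjIso H A B) (h₂ : ConjIso H B C) : ConjIso H A C := by
  obtain ⟨φ, hφ, hmul, hconj⟩ := h₁
  obtain ⟨ψ, hψ, hmul', hconj'⟩ := h₂
  refine ⟨ψ ∘ φ, hψ.comp hφ, fun a ha b hb => ?_, fun h hh n hn => ?_⟩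
  · simp only [Function.comp_apply]
    rw [hmul a ha b hb, hmul' _ (hφ.mapsTo ha) _ (hφ.mapsTo hb)]
  · simp only [Function.comp_apply]
    rw [hconj h hh n hn, hconj' h hh _ (hφ.mapsTo hn)]

theorem symm (hA : A.Normal) (h : ConjIso H A B) : ConjIso H B A := by
  obtain ⟨φ, hφ, hmul, hconj⟩ := h
  have hinv := hφ.invOn_invFunOn
  have hψ : Set.BijOn (Function.invFunOn φ A) B A := Set.BijOn.symm hinv.symm hφ
  refine ⟨Function.invFunOn φ A, hψ, fun a ha b hb => ?_, fun h hh n hn => ?_⟩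
  · obtain ⟨a, ha', rfl⟩ := hφ.surjOn ha
    obtain ⟨b, hb', rfl⟩ := hφ.surjOn hb
    rw [← hmul a ha' b hb', hinv.1 ha', hinv.1 hb', hinv.1 (A.mul_mem ha' hb')]
  · obtain ⟨n, hn', rfl⟩ := hφ.surjOn hn
    rw [← hconj h hh n hn', hinv.1 hn', hinv.1 (hA.conj_mem n hn' h)]

theorem map (e : G →* M) (he : Function.Injective e) (h : ConjIso H A B) :
    ConjIso (H.map e) (A.map e) (B.map e) := by
  obtain ⟨φ, hφ, hmul, hconj⟩ := h
  have key : ∀ g, e (φ (Function.invFun e (e g))) = e (φ g) := fun g => by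
    rw [Function.leftInverse_invFun he g]
  refine ⟨fun m => e (φ (Function.invFun e m)), ⟨?_, ?_, ?_⟩, ?_, ?_⟩
  · rintro _ ⟨a, ha, rfl⟩
    exact ⟨φ a, hφ.mapsTo ha, (key a).symm⟩
  · rintro _ ⟨a, ha, rfl⟩ _ ⟨b, hb, rfl⟩ hab
    simp only [key] at hab
    rw [hφ.injOn ha hb (he hab)]
  · rintro _ ⟨b, hb, rfl⟩
    obtain ⟨a, ha, rfl⟩ := hφ.surjOn hb
    exact ⟨e a, ⟨a, ha, rfl⟩, key a⟩
  · rintro _ ⟨a, ha, rfl⟩ _ ⟨b, hb, rfl⟩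
    simp only [← map_mul, key]
    rw [hmul a ha b hb]
  · rintro _ ⟨h, hh, rfl⟩ _ ⟨n, hn, rfl⟩
    simp only [← map_mul, ← map_inv, key]
    rw [hconj h hh n hn]

/-- If `H` centralizes `A`, it centralizes every `H`-isomorphic subgroup. -/
theorem conj_eq (h : ConjIso H A B) (hA : ∀ k ∈ H, ∀ n ∈ A, k * n * k⁻¹ = n) :
    ∀ k ∈ H, ∀ n ∈ B, k * n * k⁻¹ = n := by
  obtain ⟨φ, hφ, -, hconj⟩ := h
  intro k hk n hn
  obtain ⟨a, ha, rfl⟩ := hφ.surjOn hn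
  rw [← hconj k hk a ha, hA k hk a ha]

end ConjIso

/-- `V` is an abelian normal subgroup of `G`, the internal direct product of pairwise
`H`-isomorphic minimal normal subgroups `N i`, with a complement `H` of prime order. -/
structure HomogeneousSplitting {G : Type*} [Group G] {δ : ℕ} (N : Fin δ → Subgroup G)
    (V H : Subgroup G) : Prop where
  normal : ∀ i, (N i).Normal
  ne_bot : ∀ i, N i ≠ ⊥
  minimal : ∀ i, ∀ W : Subgroup G, W ≤ N i → W.Normal → W = ⊥ ∨ W = N i
  comm : ∀ a ∈ V, ∀ b ∈ V, a * b = b * a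
  eq_iSup : V = ⨆ i, N i
  indep : iSupIndep N
  isComplement : V.IsComplement' H
  card_prime : (Nat.card H).Prime
  iso : ∀ i j, ConjIso H (N i) (N j)

namespace HomogeneousSplitting

variable {G : Type*} [Group G] {δ : ℕ} {N : Fin δ → Subgroup G} {V H : Subgroup G}

theorem le (hS : HomogeneousSplitting N V H) (i : Fin δ) : N i ≤ V :=
  hS.eq_iSup ▸ le_iSup N i

theorem normal_sup (hS : HomogeneousSplitting N V H) : V.Normal := by
  rw [hS.eq_iSup]
  refine ⟨fun v hv g => ?_⟩
  induction hv using Subgroup.iSup_induction' with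
  | hp i x hx => exact Subgroup.mem_iSup_of_mem i ((hS.normal i).conj_mem x hx g)
  | h1 => simp
  | hmul x y _ _ h1 h2 => simpa using Subgroup.mul_mem _ h1 h2

theorem isCoatom (hS : HomogeneousSplitting N V H) [Finite G] : IsCoatom V := by
  have hindex : V.index = Nat.card H := hS.isComplement.symm.index_eq_card
  refine ⟨fun h => ?_, fun W hW => ?_⟩
  · rw [h, Subgroup.index_top] at hindex
    exact hS.card_prime.one_lt.ne hindex
  · have h1 := Subgroup.relIndex_mul_index hW.le
    rw [hindex] at h1
    rcases (Nat.dvd_prime hS.card_prime).mp (Dvd.intro_left _ h1) with h2 | h2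
    · exact Subgroup.index_eq_one.mp h2
    · exfalso
      rw [h2] at h1
      have h3 : V.relIndex W = 1 := by
        have := hS.card_prime.pos
        nlinarith
      exact absurd (Subgroup.relIndex_eq_one.mp h3) (not_le_of_gt hW)

theorem closure_cons_eq_top (hS : HomogeneousSplitting N V H) [Finite G] {h : G} (hh : h ∉ V)
    {z : Fin δ → G} (hz : ∀ i, z i ∈ N i) (hz1 : ∀ i, z i ≠ 1) :
    Subgroup.closure (Set.range (Fin.cons h z : Fin (δ + 1) → G)) = ⊤ := by
  set C := Subgroup.closure (Set.range (Fin.cons h z : Fin (δ + 1) → G)) with hC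
  have hhC : h ∈ C := Subgroup.subset_closure ⟨0, by simp⟩
  have hzC : ∀ i, z i ∈ C := fun i => Subgroup.subset_closure ⟨i.succ, by simp⟩
  have hsup : C ⊔ V = ⊤ := by
    refine hS.isCoatom.2 _ (lt_of_le_of_ne le_sup_right fun heq => hh ?_)
    rw [heq]
    exact Subgroup.mem_sup_left hhC
  have hNC : ∀ i, N i ≤ C := by
    intro i
    have hnormal : (C ⊓ N i).Normal := by
      refine ⟨fun w hw g => ?_⟩
      have hg : g ∈ C ⊔ V := hsup ▸ Subgroup.mem_top g
      have := hS.normal_sup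
      obtain ⟨c, hc, v, hv, rfl⟩ := Subgroup.mem_sup_of_normal_right.mp hg
      have h1 := hS.comm v hv w (hS.le i hw.2)
      have h2 : c * v * w * (c * v)⁻¹ = c * w * c⁻¹ := by
        calc c * v * w * (c * v)⁻¹ = c * (v * w) * v⁻¹ * c⁻¹ := by group
          _ = _ := by rw [h1]; group
      rw [h2]
      exact ⟨C.mul_mem (C.mul_mem hc hw.1) (C.inv_mem hc), (hS.normal i).conj_mem _ hw.2 _⟩
    rcases hS.minimal i _ inf_le_right hnormal with h1 | h1
    · have : z i ∈ C ⊓ N i := ⟨hzC i, hz i⟩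
      rw [h1, Subgroup.mem_bot] at this
      exact absurd this (hz1 i)
    · exact inf_eq_right.mp h1
  rw [← hsup, left_eq_sup, hS.eq_iSup]
  exact iSup_le hNC

theorem exists_mem_ne_one (hS : HomogeneousSplitting N V H) (i : Fin δ) : ∃ z ∈ N i, z ≠ 1 := by
  by_contra! h
  exact hS.ne_bot i ((Subgroup.eq_bot_iff_forall _).mpr h)

theorem exists_zpowers_eq (hS : HomogeneousSplitting N V H) :
    ∃ h, h ∉ V ∧ Subgroup.zpowers h = H := by
  have := Fact.mk hS.card_prime
  have hcyc : IsCyclic H := isCyclic_of_prime_card rfl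
  obtain ⟨h, hh⟩ := (Subgroup.isCyclic_iff_exists_zpowers_eq_top H).mp hcyc
  refine ⟨h, fun hV => ?_, hh⟩
  have hle : H ≤ V := hh ▸ (Subgroup.zpowers_le.mpr hV)
  have hbot : H = ⊥ := by
    rw [← le_bot_iff, ← hS.isComplement.disjoint.eq_bot]
    exact le_inf hle le_rfl
  have := hS.card_prime.one_lt
  rw [hbot, Subgroup.card_bot] at this
  exact lt_irrefl _ this

end HomogeneousSplitting

namespace HomogeneousSplitting

open scoped commutatorElement

variable {G M : Type*} [Group G] [Group M] {p : G →* M} {e : M →* G} {δ : ℕ}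
  {N : Fin δ → Subgroup M} {V H : Subgroup M}

/-- When `G` needs many generators, the generators `h, z` of `M` can be lifted prescribing the
lift of `z i`. -/
theorem exists_section_update (hS : HomogeneousSplitting N V H) [Finite G] [Finite M]
    (hs : MinimalSplit p e) (hlt : δ + 1 < minGen G) {h : M} (hh : h ∉ V) {i : Fin δ} {z : M}
    (hz : z ∈ N i) (hz1 : z ≠ 1) {n : G} (hn : n ∈ p.ker) :
    ∃ s : M →* G, (∀ m, p (s m) = m) ∧ s h = e h ∧ s z = n * e z := by
  choose y hy hy1 using hS.exists_mem_ne_one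
  have hx := hS.closure_cons_eq_top hh (z := Function.update y i z)
    (fun j => by
      rcases eq_or_ne j i with rfl | hj
      · simpa using hz
      · simpa [hj] using hy j)
    (fun j => by
      rcases eq_or_ne j i with rfl | hj
      · simpa using hz1
      · simpa [hj] using hy1 j)
  obtain ⟨s, hsec, hsx⟩ := hs.exists_section_of_lt hlt hx
    (Fin.cons (e h) (Function.update (fun j => e (y j)) i (n * e z)))
    (fun j => by
      refine Fin.cases ?_ (fun j => ?_) j
      · simp [hs.apply_section]
      · rcases eq_or_ne j i with rfl | hj
        · simp [hs.apply_section, MonoidHom.mem_ker.mp hn]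
        · simp [hj, hs.apply_section])
  refine ⟨s, hsec, by simpa using hsx 0, by simpa using hsx i.succ⟩

/-- The commutation forced on the kernel by lifting the relation `[z, h z h⁻¹] = 1`. -/
theorem commutator_eq (hS : HomogeneousSplitting N V H) [Finite G] [Finite M]
    (hs : MinimalSplit p e) (hlt : δ + 1 < minGen G) {h : M} (hh : h ∉ V) {i : Fin δ} {z : M}
    (hz : z ∈ N i) (hz1 : z ≠ 1) {n : G} (hn : n ∈ p.ker) :
    ⁅e (h * z * h⁻¹), n⁆ = ⁅e z, e h * n * (e h)⁻¹⁆ := by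
  obtain ⟨s, hsec, hsh, hsz⟩ := hS.exists_section_update hs hlt hh hz hz1 hn
  have hw : h * z * h⁻¹ ∈ N i := (hS.normal i).conj_mem z hz h
  have hcomm := hS.comm _ (hS.le i hz) _ (hS.le i hw)
  have hsw : s (h * z * h⁻¹) = (e h * n * (e h)⁻¹) * e (h * z * h⁻¹) := by
    simp only [map_mul, map_inv, hsh, hsz]
    group
  have h1 := congrArg s hcomm
  rw [map_mul s z, map_mul s _ z, hsw, hsz] at h1
  have h2 := congrArg e hcomm
  rw [map_mul e z, map_mul e _ z] at h2
  set w := e (h * z * h⁻¹) with hwdef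
  set m := e h * n * (e h)⁻¹ with hm
  have hmk : m ∈ p.ker := p.normal_ker.conj_mem _ hn _
  have h3 : n * (e z * m * (e z)⁻¹) = m * (w * n * w⁻¹) := by
    calc n * (e z * m * (e z)⁻¹) = n * e z * (m * w) * (e z * w)⁻¹ := by group
      _ = m * w * (n * e z) * (w * e z)⁻¹ := by rw [h1, h2]
      _ = _ := by group
  have h4 : w * n * w⁻¹ ∈ p.ker := p.normal_ker.conj_mem _ hn _
  have h5 : e z * m * (e z)⁻¹ ∈ p.ker := p.normal_ker.conj_mem _ hmk _
  rw [commutatorElement_def, commutatorElement_def, mul_inv_eq_iff_eq_mul]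
  calc w * n * w⁻¹ = m⁻¹ * (m * (w * n * w⁻¹)) := by group
    _ = m⁻¹ * (n * (e z * m * (e z)⁻¹)) := by rw [h3]
    _ = m⁻¹ * ((e z * m * (e z)⁻¹) * n) := by rw [hs.ker_comm _ hn _ h5]
    _ = m⁻¹ * (e z * m * (e z)⁻¹) * n := by group
    _ = _ := by rw [hs.ker_comm _ (p.ker.inv_mem hmk) _ h5]

/-- The factors `N i` centralize the kernel. -/
theorem commute_ker (hS : HomogeneousSplitting N V H) [Finite G] [Finite M]
    (hs : MinimalSplit p e) (hlt : δ + 1 < minGen G) {i : Fin δ} {z : M}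
    (hz : z ∈ N i) {n : G} (hn : n ∈ p.ker) : e z * n = n * e z := by
  rcases eq_or_ne z 1 with rfl | hz1
  · simp
  have hVN := hS.normal_sup
  obtain ⟨h, hh, -⟩ := hS.exists_zpowers_eq
  have hzz : ∀ m ∈ p.ker, ⁅e z, ⁅e z, m⁆⁆ = 1 := by
    intro m hm
    have hzh : z * h ∉ V := fun hc => hh ((V.mul_mem_cancel_left (hS.le i hz)).mp hc)
    have hk : (e h)⁻¹ * m * e h ∈ p.ker := by
      simpa using p.normal_ker.conj_mem m hm (e h)⁻¹
    have h1 := hS.commutator_eq hs hlt hh hz hz1 hk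
    have h2 := hS.commutator_eq hs hlt hzh hz hz1 hk
    have hw : h * z * h⁻¹ ∈ N i := (hS.normal i).conj_mem z hz h
    have hcomm := hS.comm _ (hS.le i hz) _ (hS.le i hw)
    have h3 : z * h * z * (z * h)⁻¹ = h * z * h⁻¹ := by
      calc z * h * z * (z * h)⁻¹ = z * (h * z * h⁻¹) * z⁻¹ := by group
        _ = _ := by rw [hcomm, mul_inv_cancel_right]
    rw [h3, h1] at h2
    have h4 : e h * ((e h)⁻¹ * m * e h) * (e h)⁻¹ = m := by group
    have h5 : e (z * h) * ((e h)⁻¹ * m * e h) * (e (z * h))⁻¹ = e z * m * (e z)⁻¹ := by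
      rw [map_mul]
      group
    rw [h4, h5] at h2
    have h6 : e z * ⁅e z, m⁆ * (e z)⁻¹ = ⁅e z, e z * m * (e z)⁻¹⁆ := by
      simp only [commutatorElement_def]
      group
    rw [commutatorElement_def (e z) ⁅e z, m⁆, h6, ← h2, mul_inv_cancel]
  set S : Set G := {g | ∃ m ∈ p.ker, g = ⁅e z, m⁆} with hSdef
  have hSker : Subgroup.closure S ≤ p.ker := by
    rw [Subgroup.closure_le]
    rintro _ ⟨m, hm, rfl⟩
    rw [commutatorElement_def]
    exact p.ker.mul_mem (p.normal_ker.conj_mem _ hm _) (p.ker.inv_mem hm)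
  have hcent : ∀ c ∈ Subgroup.closure S, e z * c = c * e z := by
    have : Subgroup.closure S ≤ Subgroup.centralizer {e z} := by
      rw [Subgroup.closure_le]
      rintro _ ⟨m, hm, rfl⟩
      exact Subgroup.mem_centralizer_singleton_iff.mpr
        (commutatorElement_eq_one_iff_mul_comm.mp (hzz m hm)).symm
    exact fun c hc => (Subgroup.mem_centralizer_singleton_iff.mp (this hc)).symm
  have hinvS : ∀ k ∉ V, ∀ c ∈ Subgroup.closure S, e k * c * (e k)⁻¹ ∈ Subgroup.closure S := by
    intro k hk c hc
    induction hc using Subgroup.closure_induction with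
    | mem c hc =>
      obtain ⟨m, hm, rfl⟩ := hc
      have hm' : e k * m * (e k)⁻¹ ∈ p.ker := p.normal_ker.conj_mem _ hm _
      have h1 : e k * ⁅e z, m⁆ * (e k)⁻¹ = ⁅e (k * z * k⁻¹), e k * m * (e k)⁻¹⁆ := by
        simp only [commutatorElement_def, map_mul, map_inv]
        group
      rw [h1, hS.commutator_eq hs hlt hk hz hz1 hm']
      exact Subgroup.subset_closure ⟨_, p.normal_ker.conj_mem _ hm' _, rfl⟩
    | one => simp
    | mul a b _ _ ha hb => simpa using Subgroup.mul_mem _ ha hb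
    | inv a _ ha => simpa [mul_assoc] using Subgroup.inv_mem _ ha
  have hinv : ∀ k, ∀ c ∈ Subgroup.closure S, e k * c * (e k)⁻¹ ∈ Subgroup.closure S := by
    intro k c hc
    by_cases hk : k ∈ V
    · have h1 : k * h ∉ V := fun hc' => hh ((V.mul_mem_cancel_left hk).mp hc')
      have h2 : h⁻¹ ∉ V := fun hc' => hh (by simpa using V.inv_mem hc')
      have h3 := hinvS _ h1 _ (hinvS _ h2 c hc)
      have h4 : e (k * h) * (e h⁻¹ * c * (e h⁻¹)⁻¹) * (e (k * h))⁻¹ = e k * c * (e k)⁻¹ := by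
        simp only [map_mul, map_inv]
        group
      rwa [h4] at h3
    · exact hinvS k hk c hc
  rcases hs.eq_bot_or_eq_ker hSker hinv with h1 | h1
  · have h2 : ⁅e z, n⁆ ∈ Subgroup.closure S := Subgroup.subset_closure ⟨n, hn, rfl⟩
    rw [h1, Subgroup.mem_bot] at h2
    exact commutatorElement_eq_one_iff_mul_comm.mp h2
  · exact hcent n (h1 ▸ hn)

theorem commute_ker_of_mem (hS : HomogeneousSplitting N V H) [Finite G] [Finite M]
    (hs : MinimalSplit p e) (hlt : δ + 1 < minGen G) {v : M} (hv : v ∈ V) {n : G}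
    (hn : n ∈ p.ker) : e v * n = n * e v := by
  have hle : V ≤ (Subgroup.centralizer {n}).comap e := by
    rw [hS.eq_iSup]
    exact iSup_le fun i z hz =>
      Subgroup.mem_centralizer_singleton_iff.mpr (hS.commute_ker hs hlt hz hn)
  exact Subgroup.mem_centralizer_singleton_iff.mp (hle hv)

theorem exists_eq_mul (hS : HomogeneousSplitting N V H) (m : M) :
    ∃ v ∈ V, ∃ h ∈ H, m = v * h := by
  obtain ⟨⟨v, h⟩, hvh⟩ := hS.isComplement.2 m
  exact ⟨v, v.2, h, h.2, hvh.symm⟩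

/-- Each factor `N i` is isomorphic to the kernel as an `H`-module. -/
theorem conjIso_ker (hS : HomogeneousSplitting N V H) [Finite G] [Finite M]
    (hs : MinimalSplit p e) (hlt : δ + 1 < minGen G) (i : Fin δ) :
    ConjIso (H.map e) ((N i).map e) p.ker := by
  obtain ⟨h, hh, hgen⟩ := hS.exists_zpowers_eq
  obtain ⟨z, hz, hz1⟩ := hS.exists_mem_ne_one i
  obtain ⟨n, hn, hn1⟩ := hs.exists_mem_ker_ne_one
  obtain ⟨s, hsec, hsh, hsz⟩ := hS.exists_section_update hs hlt hh hz hz1 hn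
  have hsH : ∀ k ∈ H, s k = e k := by
    intro k hk
    rw [← hgen] at hk
    obtain ⟨j, rfl⟩ := Subgroup.mem_zpowers_iff.mp hk
    rw [map_zpow, map_zpow, hsh]
  have hker : ∀ m, s m * (e m)⁻¹ ∈ p.ker := fun m => by
    simp [MonoidHom.mem_ker, hsec, hs.apply_section]
  have hmul : ∀ a ∈ V, ∀ b, s (a * b) * (e (a * b))⁻¹ = s a * (e a)⁻¹ * (s b * (e b)⁻¹) := by
    intro a ha b
    have h1 := hS.commute_ker_of_mem hs hlt (V.inv_mem ha) (hker b)
    rw [map_inv] at h1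
    calc s (a * b) * (e (a * b))⁻¹ = s a * ((s b * (e b)⁻¹) * (e a)⁻¹) := by
          simp only [map_mul]
          group
      _ = _ := by rw [← h1]; group
  have hconj : ∀ k ∈ H, ∀ v, s (k * v * k⁻¹) * (e (k * v * k⁻¹))⁻¹ =
      e k * (s v * (e v)⁻¹) * (e k)⁻¹ := by
    intro k hk v
    simp only [map_mul, map_inv, hsH k hk]
    group
  have hconjV : ∀ u ∈ V, ∀ v ∈ V, u * v * u⁻¹ = v := fun u hu v hv => by
    rw [hS.comm u hu v hv, mul_inv_cancel_right]
  have hbot : N i ⊓ s.eqLocus e = ⊥ := by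
    have hnormal : (N i ⊓ s.eqLocus e).Normal := by
      refine ⟨fun v hv m => ?_⟩
      refine ⟨(hS.normal i).conj_mem v hv.1 m, ?_⟩
      obtain ⟨u, hu, k, hk, rfl⟩ := hS.exists_eq_mul m
      have h1 : u * k * v * (u * k)⁻¹ = k * v * k⁻¹ := by
        rw [← hconjV u hu (k * v * k⁻¹) (hS.normal_sup.conj_mem v (hS.le i hv.1) k)]
        group
      have h2 : s v = e v := hv.2
      change s _ = e _
      rw [h1]
      simp only [map_mul, map_inv, hsH k hk, h2]
    rcases hS.minimal i _ inf_le_left hnormal with h1 | h1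
    · exact h1
    · have h3 : s z = e z := inf_eq_left.mp h1 hz
      rw [hsz] at h3
      exact absurd (mul_eq_right.mp h3) hn1
  let φ : N i →* G := MonoidHom.mk' (fun v => s v * (e v)⁻¹)
    fun a b => hmul a (hS.le i a.2) b
  have hφ : φ.range = p.ker := by
    refine (hs.eq_bot_or_eq_ker ?_ ?_).resolve_left ?_
    · rintro _ ⟨v, rfl⟩
      exact hker v
    · rintro m _ ⟨v, rfl⟩
      obtain ⟨u, hu, k, hk, rfl⟩ := hS.exists_eq_mul m
      refine ⟨⟨k * v * k⁻¹, (hS.normal i).conj_mem v v.2 k⟩, ?_⟩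
      change s (k * v * k⁻¹) * (e (k * v * k⁻¹))⁻¹ =
        e (u * k) * (s v * (e v)⁻¹) * (e (u * k))⁻¹
      have h1 := hS.commute_ker_of_mem hs hlt hu (hker (k * v * k⁻¹))
      rw [hconj k hk] at h1 ⊢
      calc e k * (s v * (e v)⁻¹) * (e k)⁻¹ = e k * (s v * (e v)⁻¹) * (e k)⁻¹ * e u * (e u)⁻¹ := by
            group
        _ = _ := by rw [← h1, map_mul]; group
    · intro hbot'
      have h1 : φ ⟨z, hz⟩ ∈ φ.range := ⟨_, rfl⟩
      rw [hbot', Subgroup.mem_bot] at h1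
      have h2 : s z * (e z)⁻¹ = 1 := h1
      rw [hsz, mul_inv_cancel_right] at h2
      exact hn1 h2
  have hinj : Function.Injective φ := by
    rw [injective_iff_map_eq_one]
    intro v hv
    have h1 : s v * (e v)⁻¹ = 1 := hv
    have h2 : (v : M) ∈ N i ⊓ s.eqLocus e := ⟨v.2, mul_inv_eq_one.mp h1⟩
    rw [hbot, Subgroup.mem_bot] at h2
    exact Subtype.ext h2
  have key : ∀ m, s (p (e m)) * (e m)⁻¹ = s m * (e m)⁻¹ := fun m => by rw [hs.apply_section]
  refine ⟨fun g => s (p g) * g⁻¹, ⟨?_, ?_, ?_⟩, ?_, ?_⟩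
  · rintro _ ⟨v, hv, rfl⟩
    simp only [key]
    exact hker v
  · rintro _ ⟨a, ha, rfl⟩ _ ⟨b, hb, rfl⟩ hab
    simp only [key] at hab
    have : (⟨a, ha⟩ : N i) = ⟨b, hb⟩ := hinj hab
    rw [Subtype.mk.inj this]
  · intro c hc
    have hc' : c ∈ φ.range := hφ ▸ hc
    obtain ⟨v, rfl⟩ := hc'
    exact ⟨e v, ⟨v, v.2, rfl⟩, key v⟩
  · rintro _ ⟨a, ha, rfl⟩ _ ⟨b, hb, rfl⟩
    simp only [← map_mul, key]
    exact hmul a (hS.le i ha) b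
  · rintro _ ⟨k, hk, rfl⟩ _ ⟨v, hv, rfl⟩
    simp only [← map_mul, ← map_inv e k, key]
    rw [hconj k hk]
    simp only [map_inv]

end HomogeneousSplitting

namespace HomogeneousSplitting

variable {G M : Type*} [Group G] [Group M] {p : G →* M} {e : M →* G} {δ : ℕ}
  {N : Fin δ → Subgroup M} {V H : Subgroup M}

/-- A homogeneous splitting of `M` extends to `G` when `G` needs more than `δ + 1` generators. -/
theorem extend (hS : HomogeneousSplitting N V H) [Finite G] (hs : MinimalSplit p e)
    (hlt : δ + 1 < minGen G) :
    HomogeneousSplitting (Fin.cons p.ker fun i => (N i).map e : Fin (δ + 1) → Subgroup G)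
      (p.ker ⊔ V.map e) (H.map e) := by
  have : Finite M := Finite.of_surjective p hs.surjective
  have he : Function.Injective e := Function.LeftInverse.injective hs.apply_section
  have hcomm : ∀ v ∈ V, ∀ n ∈ p.ker, e v * n = n * e v :=
    fun v hv n hn => hS.commute_ker_of_mem hs hlt hv hn
  have hmem : ∀ {B : Subgroup M} {m : M}, e m ∈ p.ker ⊔ B.map e → m ∈ B := by
    intro B m hm
    obtain ⟨k, hk, _, ⟨b, hb, rfl⟩, hkb⟩ := Subgroup.mem_sup_of_normal_left.mp hm
    have h1 := congrArg p hkb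
    rw [map_mul, MonoidHom.mem_ker.mp hk, one_mul, hs.apply_section, hs.apply_section] at h1
    exact h1 ▸ hb
  have hnormal : ∀ i, ((N i).map e).Normal := by
    refine fun i => ⟨?_⟩
    rintro _ ⟨v, hv, rfl⟩ g
    have hk := hs.mul_inv_mem_ker g
    have hv' := (hS.normal i).conj_mem v hv (p g)
    refine ⟨p g * v * (p g)⁻¹, hv', ?_⟩
    have h1 := hcomm _ (hS.le i hv') _ hk
    calc e (p g * v * (p g)⁻¹)
        = e (p g * v * (p g)⁻¹) * (g * (e (p g))⁻¹) * (g * (e (p g))⁻¹)⁻¹ := by group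
      _ = _ := by
        rw [h1]
        simp only [map_mul, map_inv]
        group
  have hker : ∀ i, ConjIso (H.map e) ((N i).map e) p.ker := hS.conjIso_ker hs hlt
  refine ⟨?_, ?_, ?_, ?_, ?_, ?_, ?_, ?_, ?_⟩
  · exact Fin.cases p.normal_ker hnormal
  · refine Fin.cases hs.ker_ne_bot fun i => ?_
    simpa [Subgroup.map_eq_bot_iff_of_injective _ he] using hS.ne_bot i
  · refine Fin.cases hs.ker_min fun i W hW hWn => ?_
    simp only [Fin.cons_succ] at hW ⊢
    have hWe : (W.comap e).map e = W :=
      Subgroup.map_comap_eq_self (hW.trans (Subgroup.map_le_range e _))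
    rcases hS.minimal i (W.comap e) (fun v hv => by
        obtain ⟨u, hu, huv⟩ := hW hv
        exact he huv ▸ hu) (hWn.comap e) with h1 | h1
    · left
      rw [← hWe, h1, Subgroup.map_bot]
    · right
      rw [← hWe, h1]
  · intro a ha b hb
    obtain ⟨k, hk, _, ⟨u, hu, rfl⟩, rfl⟩ := Subgroup.mem_sup_of_normal_left.mp ha
    obtain ⟨l, hl, _, ⟨v, hv, rfl⟩, rfl⟩ := Subgroup.mem_sup_of_normal_left.mp hb
    calc k * e u * (l * e v) = k * (e u * l) * e v := by group
      _ = (k * l) * (e u * e v) := by rw [hcomm u hu l hl]; group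
      _ = (l * k) * (e v * e u) := by
        rw [hs.ker_comm k hk l hl, ← map_mul, ← map_mul, hS.comm u hu v hv]
      _ = l * (k * e v) * e u := by group
      _ = _ := by rw [← hcomm v hv k hk]; group
  · rw [hS.eq_iSup, Subgroup.map_iSup]
    refine le_antisymm (sup_le ?_ (iSup_le fun i => ?_)) (iSup_le (Fin.cases ?_ fun i => ?_))
    · exact le_iSup (Fin.cons p.ker fun i => (N i).map e : Fin (δ + 1) → Subgroup G) 0
    · exact le_iSup (Fin.cons p.ker fun i => (N i).map e : Fin (δ + 1) → Subgroup G) i.succ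
    · exact le_sup_left
    · exact le_sup_of_le_right (le_iSup (fun i => (N i).map e) i)
  · refine Fin.cases ?_ fun i => ?_
    · refine Disjoint.mono_right (c := V.map e) (iSup₂_le (Fin.cases ?_ fun j _ => ?_)) ?_
      · rw [Subgroup.disjoint_def]
        rintro _ hk ⟨v, -, rfl⟩
        rw [Fin.cons_zero, MonoidHom.mem_ker, hs.apply_section] at hk
        rw [hk, map_one]
      · exact fun h => absurd rfl h
      · exact Subgroup.map_mono (hS.le j)
    · refine Disjoint.mono_right (c := p.ker ⊔ (⨆ j, ⨆ (_ : j ≠ i), N j).map e)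
        (iSup₂_le (Fin.cases ?_ fun j hj => ?_)) ?_
      · rw [Subgroup.disjoint_def]
        rintro _ ⟨v, hv, rfl⟩ hv'
        rw [Subgroup.disjoint_def.mp (hS.indep i) hv (hmem hv'), map_one]
      · exact fun _ => le_sup_left
      · exact le_sup_of_le_right (Subgroup.map_mono
          (le_iSup₂_of_le j (fun h => hj (congrArg _ h)) le_rfl))
  · refine Subgroup.isComplement'_of_disjoint_and_mul_eq_univ ?_ ?_
    · rw [Subgroup.disjoint_def]
      rintro _ hh' ⟨h, hh, rfl⟩
      rw [Subgroup.disjoint_def.mp hS.isComplement.disjoint (hmem hh') hh, map_one]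
    · refine Set.eq_univ_of_forall fun g => ?_
      obtain ⟨v, hv, h, hh, hvh⟩ := hS.exists_eq_mul (p g)
      refine ⟨g * (e (p g))⁻¹ * e v, ?_, e h, ⟨h, hh, rfl⟩, ?_⟩
      · exact Subgroup.mul_mem_sup (hs.mul_inv_mem_ker g) ⟨v, hv, rfl⟩
      · change g * (e (p g))⁻¹ * e v * e h = g
        rw [hvh, map_mul]
        group
  · rw [Nat.card_congr (H.equivMapOfInjective e he).toEquiv.symm]
    exact hS.card_prime
  · refine Fin.cases (Fin.cases ?_ fun j => ?_) fun i => Fin.cases ?_ fun j => ?_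
    · exact ConjIso.refl _ _
    · exact (hker j).symm (hnormal j)
    · exact hker i
    · exact (hS.iso i j).map e he

end HomogeneousSplitting

namespace MinimalSplit

variable {G M : Type*} [Group G] [Group M] {p : G →* M} {e : M →* G}

/-- A minimal split extension of a group of prime order is a homogeneous splitting. -/
theorem homogeneousSplitting (hs : MinimalSplit p e) (hM : (Nat.card M).Prime) :
    HomogeneousSplitting (fun _ : Fin 1 => p.ker) p.ker e.range := by
  refine ⟨fun _ => p.normal_ker, fun _ => hs.ker_ne_bot, fun _ => hs.ker_min, hs.ker_comm,
    ciSup_const.symm, ?_, ?_, ?_, fun _ _ => ConjIso.refl _ _⟩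
  · intro i
    have : (⨆ j, ⨆ (_ : j ≠ i), p.ker) = ⊥ :=
      iSup₂_eq_bot.mpr fun j hj => absurd (Subsingleton.elim j i) hj
    rw [this]
    exact disjoint_bot_right
  · refine Subgroup.isComplement'_of_disjoint_and_mul_eq_univ ?_ ?_
    · rw [Subgroup.disjoint_def]
      rintro _ hk ⟨m, rfl⟩
      rw [MonoidHom.mem_ker, hs.apply_section] at hk
      rw [hk, map_one]
    · refine Set.eq_univ_of_forall fun g => ⟨_, hs.mul_inv_mem_ker g, e (p g), ⟨_, rfl⟩, ?_⟩
      simp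
  · have he : Function.Injective e := Function.LeftInverse.injective hs.apply_section
    rwa [← Nat.card_congr (MonoidHom.ofInjective he).toEquiv]

end MinimalSplit

theorem Subgroup.map_eq_top_iff_sup_ker {G M : Type*} [Group G] [Group M] {p : G →* M}
    (hp : Function.Surjective p) {K : Subgroup G} : K.map p = ⊤ ↔ K ⊔ p.ker = ⊤ := by
  rw [← Subgroup.comap_map_eq, ← Subgroup.comap_top p, (Subgroup.comap_injective hp).eq_iff]

theorem nontrivial_of_minGen_pos {G : Type*} [Group G] (h : 0 < minGen G) : Nontrivial G := by
  by_contra hG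
  rw [not_nontrivial_iff_subsingleton] at hG
  exact h.not_ge (minGen_le_of_closure_range (x := Fin.elim0) (Subsingleton.elim _ _))

/-- A nontrivial finite solvable group with trivial Frattini subgroup splits over an abelian
minimal normal subgroup. -/
theorem exists_minimalSplit (G : Type*) [Group G] [Finite G] [Nontrivial G] [Group.IsSolvable G]
    (hF : frattini G = ⊥) :
    ∃ (A : Subgroup G) (_ : A.Normal) (e : G ⧸ A →* G), MinimalSplit (QuotientGroup.mk' A) e := by
  obtain ⟨A, ⟨hA, hne⟩, hmin⟩ := exists_minimal_of_wellFoundedLT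
    (fun A : Subgroup G => A.Normal ∧ A ≠ ⊥) ⟨⊤, inferInstance, top_ne_bot⟩
  have hmin' : ∀ W : Subgroup G, W ≤ A → W.Normal → W = ⊥ ∨ W = A := by
    intro W hW hWn
    by_cases h : W = ⊥
    · exact Or.inl h
    · exact Or.inr (le_antisymm hW (hmin ⟨hWn, h⟩ hW))
  have hlt := Group.IsSolvable.commutator_lt_of_ne_bot hne
  have hcomm : ∀ a ∈ A, ∀ b ∈ A, a * b = b * a := by
    have h1 : ⁅A, A⁆ = ⊥ := (hmin' _ hlt.le inferInstance).resolve_right hlt.ne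
    rw [Subgroup.commutator_eq_bot_iff_le_centralizer] at h1
    exact fun a ha b hb => (Subgroup.mem_centralizer_iff.mp (h1 ha) b hb).symm
  obtain ⟨L, hL, hAL⟩ : ∃ L : Subgroup G, IsCoatom L ∧ ¬ A ≤ L := by
    by_contra! h
    refine hne (le_bot_iff.mp (hF ▸ ?_))
    exact le_iInf₂ fun L hL => h L hL
  have hsup : A ⊔ L = ⊤ :=
    hL.2 _ (lt_of_le_of_ne le_sup_right fun h => hAL (h ▸ le_sup_left))
  have hinf : L ⊓ A = ⊥ := by
    refine (hmin' _ inf_le_right ⟨fun w hw g => ?_⟩).resolve_right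
      fun h => hAL (h ▸ inf_le_left)
    obtain ⟨a, ha, l, hl, rfl⟩ :=
      Subgroup.mem_sup_of_normal_left.mp (hsup ▸ Subgroup.mem_top g : g ∈ A ⊔ L)
    have h1 : l * w * l⁻¹ ∈ A := hA.conj_mem w hw.2 l
    have h2 : a * l * w * (a * l)⁻¹ = l * w * l⁻¹ := by
      calc a * l * w * (a * l)⁻¹ = a * (l * w * l⁻¹) * a⁻¹ := by group
        _ = _ := by rw [hcomm a ha _ h1, mul_inv_cancel_right]
    rw [h2]
    exact ⟨L.mul_mem (L.mul_mem hl hw.1) (L.inv_mem hl), h1⟩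
  have hmap : L.map (QuotientGroup.mk' A) = ⊤ := by
    rw [Subgroup.map_eq_top_iff_sup_ker (QuotientGroup.mk'_surjective A), QuotientGroup.ker_mk',
      sup_comm, hsup]
  obtain ⟨e, he, -⟩ := MinimalSplit.exists_section_of_complement hmap
    (by rwa [QuotientGroup.ker_mk'])
  refine ⟨A, hA, e, he, ?_, ?_, ?_⟩
  · rwa [QuotientGroup.ker_mk']
  · rwa [QuotientGroup.ker_mk']
  · rwa [QuotientGroup.ker_mk']

/-- The structure of Frattini-free solvable groups with the exchange property. -/
theorem exists_homogeneousSplitting.{u} (δ : ℕ) :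
    ∀ (G : Type u) [Group G] [Finite G] [Group.IsSolvable G], frattini G = ⊥ → MGSE G → minGen G = δ + 2 →
    ∃ (N : Fin (δ + 1) → Subgroup G) (V H : Subgroup G), HomogeneousSplitting N V H := by
  induction δ with
  | zero =>
    intro G _ _ _ hF hG hd
    have : Nontrivial G := nontrivial_of_minGen_pos (by lia)
    obtain ⟨A, hA, e, hs⟩ := exists_minimalSplit G hF
    have h1 := hs.minGen_eq_succ hG (by lia)
    exact ⟨_, _, _, hs.homogeneousSplitting
      (hs.card_prime_of_minGen_eq_one hG hd (by lia) (hs.frattini_eq_bot hG h1 hF))⟩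
  | succ δ ih =>
    intro G _ _ _ hF hG hd
    have : Nontrivial G := nontrivial_of_minGen_pos (by lia)
    obtain ⟨A, hA, e, hs⟩ := exists_minimalSplit G hF
    have h1 := hs.minGen_eq_succ hG (by lia)
    obtain ⟨N, V, H, hS⟩ := ih (G ⧸ A) (hs.frattini_eq_bot hG h1 hF)
      (hs.mgse_of_minGen_eq_succ hG h1) (by lia)
    exact ⟨_, _, _, hS.extend hs (by lia)⟩

section Frattini

variable {G : Type*} [Group G] [Finite G]

theorem map_mk_frattini_eq_top_iff {K : Subgroup G} :
    K.map (QuotientGroup.mk' (frattini G)) = ⊤ ↔ K = ⊤ := by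
  rw [Subgroup.map_eq_top_iff_sup_ker (QuotientGroup.mk'_surjective _), QuotientGroup.ker_mk']
  exact ⟨frattini_nongenerating, fun h => by rw [h, top_sup_eq]⟩

theorem closure_range_mk_frattini_eq_top_iff {ι : Type*} {x : ι → G} :
    Subgroup.closure (Set.range fun i => (x i : G ⧸ frattini G)) = ⊤ ↔
      Subgroup.closure (Set.range x) = ⊤ := by
  rw [← map_mk_frattini_eq_top_iff (G := G), MonoidHom.map_closure, ← Set.range_comp]
  rfl

theorem frattini_quotient_frattini : frattini (G ⧸ frattini G) = ⊥ := by
  have hsurj := QuotientGroup.mk'_surjective (frattini G)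
  have hle : (frattini (G ⧸ frattini G)).comap (QuotientGroup.mk' (frattini G)) ≤ frattini G := by
    refine le_iInf₂ fun L hL => ?_
    by_contra hn
    have h1 : L ⊔ (frattini (G ⧸ frattini G)).comap (QuotientGroup.mk' (frattini G)) = ⊤ :=
      hL.2 _ (left_lt_sup.mpr hn)
    have h2 := congrArg (Subgroup.map (QuotientGroup.mk' (frattini G))) h1
    rw [Subgroup.map_sup, Subgroup.map_comap_eq_self_of_surjective hsurj,
      Subgroup.map_top_of_surjective _ hsurj] at h2
    exact hL.1 (map_mk_frattini_eq_top_iff.mp (frattini_nongenerating h2))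
  refine (Subgroup.eq_bot_iff_forall _).mpr fun q hq => ?_
  obtain ⟨g, rfl⟩ := hsurj q
  exact (QuotientGroup.eq_one_iff g).mpr (hle hq)

theorem minGen_quotient_frattini : minGen (G ⧸ frattini G) = minGen G := by
  refine le_antisymm (minGen_le_of_surjective _ (QuotientGroup.mk'_surjective (frattini G))) ?_
  obtain ⟨x, hx⟩ := exists_closure_range_minGen (G ⧸ frattini G)
  choose y hy using fun i => QuotientGroup.mk_surjective (x i)
  refine minGen_le_of_closure_range (x := y) (closure_range_mk_frattini_eq_top_iff.mp ?_)
  simpa only [hy] using hx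

theorem MGSE.quotient_frattini (hG : MGSE G) : MGSE (G ⧸ frattini G) := by
  intro x y hx hy i
  choose x' hx' using fun i => QuotientGroup.mk_surjective (x i)
  choose y' hy' using fun i => QuotientGroup.mk_surjective (y i)
  obtain ⟨j, hj⟩ := hG.exchange minGen_quotient_frattini.symm
    ((closure_range_mk_frattini_eq_top_iff (x := x')).mp (by simpa only [hx'] using hx))
    ((closure_range_mk_frattini_eq_top_iff (x := y')).mp (by simpa only [hy'] using hy)) i
  refine ⟨j, ?_⟩
  rw [← closure_range_mk_frattini_eq_top_iff] at hj
  convert hj using 3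
  funext k
  rcases eq_or_ne k i with rfl | hk
  · simp [hy']
  · simp [hk, hx']

theorem isNilpotent_of_comm_quotient_frattini
    (h : ∀ a b : G ⧸ frattini G, a * b = b * a) : Group.IsNilpotent G := by
  have htfae : Group.IsNilpotent G ↔ ∀ L : Subgroup G, IsCoatom L → L.Normal :=
    Group.isNilpotent_of_finite_tfae.out 0 2
  refine htfae.mpr fun L hL => ⟨fun l hl g => ?_⟩
  have h1 : ((g * l * g⁻¹ * l⁻¹ : G) : G ⧸ frattini G) = 1 := by
    simp only [QuotientGroup.mk_mul, QuotientGroup.mk_inv]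
    rw [h g l, mul_inv_cancel_right, mul_inv_cancel]
  have h2 := frattini_le_coatom hL ((QuotientGroup.eq_one_iff _).mp h1)
  simpa using L.mul_mem h2 hl

end Frattini

/-- In a nonabelian group, the complement acts faithfully on each factor. -/
theorem HomogeneousSplitting.eq_one_of_conj_eq {G : Type*} [Group G] {δ : ℕ}
    {N : Fin δ → Subgroup G} {V H : Subgroup G} (hS : HomogeneousSplitting N V H)
    (hG : ¬ ∀ a b : G, a * b = b * a) (i : Fin δ) {h : G} (hh : h ∈ H)
    (hc : ∀ n ∈ N i, h * n * h⁻¹ = n) : h = 1 := by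
  by_contra hne
  have := Fact.mk hS.card_prime
  have hgen : ∀ k ∈ H, ∃ j : ℤ, h ^ j = k := by
    intro k hk
    obtain ⟨j, hj⟩ := mem_zpowers_of_prime_card (g := (⟨h, hh⟩ : H)) (g' := ⟨k, hk⟩) rfl
      (fun h1 => hne (congrArg Subtype.val h1))
    exact ⟨j, congrArg Subtype.val hj⟩
  have hcomm : ∀ k ∈ H, ∀ n ∈ N i, k * n * k⁻¹ = n := by
    intro k hk n hn
    obtain ⟨j, rfl⟩ := hgen k hk
    have : Commute h n := mul_inv_eq_iff_eq_mul.mp (hc n hn)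
    rw [(this.zpow_left j).eq, mul_inv_cancel_right]
  have hall : ∀ k ∈ H, ∀ v ∈ V, k * v = v * k := by
    intro k hk v hv
    have hle : V ≤ Subgroup.centralizer {k} := by
      rw [hS.eq_iSup]
      exact iSup_le fun j n hn => Subgroup.mem_centralizer_singleton_iff.mpr
        (mul_inv_eq_iff_eq_mul.mp ((hS.iso i j).conj_eq hcomm k hk n hn)).symm
    exact (Subgroup.mem_centralizer_singleton_iff.mp (hle hv)).symm
  have hH : ∀ k ∈ H, ∀ l ∈ H, k * l = l * k := by
    intro k hk l hl
    obtain ⟨a, rfl⟩ := hgen k hk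
    obtain ⟨b, rfl⟩ := hgen l hl
    exact ((Commute.refl h).zpow_zpow a b).eq
  refine hG fun a b => ?_
  obtain ⟨u, hu, k, hk, rfl⟩ := hS.exists_eq_mul a
  obtain ⟨v, hv, l, hl, rfl⟩ := hS.exists_eq_mul b
  calc u * k * (v * l) = u * (k * v) * l := by group
    _ = (u * v) * (k * l) := by rw [hall k hk v hv]; group
    _ = (v * u) * (l * k) := by rw [hS.comm u hu v hv, hH k hk l hl]
    _ = v * (u * l) * k := by group
    _ = _ := by rw [← hall l hl u hu]; group

/-- If a finite non-nilpotent solvable group `G` satisfies the MGSE property, then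
`Q = G/Frat(G) ≅ N^δ ⋊ H` with `H` cyclic of prime order acting faithfully and
diagonally on `N^δ`: `Q` has a complemented abelian normal subgroup `V` which is the
internal direct product of minimal normal subgroups `N 1, …, N δ` that are pairwise
`H`-isomorphic, the complement `H` being cyclic of prime order and acting faithfully
on each `N i`. -/
theorem mgse_solvable_structure {G : Type*} [Group G] [Finite G]
    (hsol : IsSolvable G) (hnil : ¬ Group.IsNilpotent G) (h : MGSE G) :
    ∃ δ : ℕ, 1 ≤ δ ∧
      ∃ (N : Fin δ → Subgroup (G ⧸ frattini G)) (V H : Subgroup (G ⧸ frattini G)),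
        (∀ i, (N i).Normal) ∧
        (∀ i, N i ≠ ⊥) ∧
        (∀ i, ∀ W : Subgroup (G ⧸ frattini G), W ≤ N i → W.Normal → W = ⊥ ∨ W = N i) ∧
        V.Normal ∧
        (∀ a ∈ V, ∀ b ∈ V, a * b = b * a) ∧
        V = ⨆ i, N i ∧
        iSupIndep N ∧
        V.IsComplement' H ∧
        IsCyclic H ∧ (Nat.card H).Prime ∧
        (∀ i, ∀ h ∈ H, (∀ n ∈ N i, h * n * h⁻¹ = n) → h = 1) ∧
        (∀ i j, ∃ φ : (G ⧸ frattini G) → (G ⧸ frattini G),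
          Set.BijOn φ (N i) (N j) ∧
          (∀ a ∈ N i, ∀ b ∈ N i, φ (a * b) = φ a * φ b) ∧
          (∀ h ∈ H, ∀ n ∈ N i, φ (h * n * h⁻¹) = h * φ n * h⁻¹)) := by
  have : Group.IsSolvable G := hsol
  have hnab : ¬ ∀ a b : G ⧸ frattini G, a * b = b * a :=
    fun hab => hnil (isNilpotent_of_comm_quotient_frattini hab)
  have hd : 2 ≤ minGen (G ⧸ frattini G) := by
    by_contra hlt
    obtain ⟨c, hc⟩ := exists_zpowers_eq_top_of_minGen_le_one (G := G ⧸ frattini G) (by lia)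
    refine hnab fun a b => ?_
    obtain ⟨k, rfl⟩ := Subgroup.mem_zpowers_iff.mp (hc ▸ Subgroup.mem_top a)
    obtain ⟨l, rfl⟩ := Subgroup.mem_zpowers_iff.mp (hc ▸ Subgroup.mem_top b)
    exact ((Commute.refl c).zpow_zpow k l).eq
  obtain ⟨δ, hδ⟩ := Nat.exists_eq_add_of_le' hd
  obtain ⟨N, V, H, hS⟩ := exists_homogeneousSplitting δ (G ⧸ frattini G)
    frattini_quotient_frattini h.quotient_frattini hδ
  have := Fact.mk hS.card_prime
  exact ⟨δ + 1, by lia, N, V, H, hS.normal, hS.ne_bot, hS.minimal, hS.normal_sup, hS.comm,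
    hS.eq_iSup, hS.indep, hS.isComplement, isCyclic_of_prime_card rfl, hS.card_prime,
    fun i k hk hc => hS.eq_one_of_conj_eq hnab i hk hc, hS.iso⟩
end

section
/- Let p be a prime, let F be a finite field, and let x ∈ F be an element of multiplicative order p such that F is generated as a field by x over its prime field (so that the additive group V of F is a faithful irreducible module for the cyclic group ⟨x⟩ of order p, with x acting by multiplication). Then for every δ ≥ 1 the semidirect product G = V^δ ⋊ ⟨x⟩, where x acts on V^δ = F^δ by componentwise multiplication, satisfies the MGSE property. -/
/-- The action of the cyclic subgroup `⟨x⟩ ≤ Fˣ` on `V^δ = F^δ` (written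
multiplicatively) by componentwise multiplication. -/
noncomputable def zpowersSMulAct {F : Type*} [Field F] (x : Fˣ) (δ : ℕ) :
    (Subgroup.zpowers x) →* MulAut (Multiplicative (Fin δ → F)) where
  toFun u := AddEquiv.toMultiplicative
    (DistribMulAction.toAddAut Fˣ (Fin δ → F) (u : Fˣ))
  map_one' := by
    ext v
    simp [AddEquiv.toMultiplicative]
  map_mul' a b := by
    ext v
    simp [AddEquiv.toMultiplicative, mul_smul]

section CrossedHom

variable {F : Type*} [Field F] {x : Fˣ} {δ : ℕ}

/-- The crossed homomorphism `(v, u) ↦ (v, u - 1)` from `F^δ ⋊ ⟨x⟩` to `F^δ × F`. -/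
def crossedHom
    (g : SemidirectProduct (Multiplicative (Fin δ → F)) (Subgroup.zpowers x)
      (zpowersSMulAct x δ)) : (Fin δ → F) × F :=
  (g.left.toAdd, ((g.right : Fˣ) : F) - 1)

theorem toAdd_zpowersSMulAct (u : Subgroup.zpowers x) (v : Multiplicative (Fin δ → F)) :
    (zpowersSMulAct x δ u v).toAdd = ((u : Fˣ) : F) • v.toAdd := rfl

theorem crossedHom_mul
    (g h : SemidirectProduct (Multiplicative (Fin δ → F)) (Subgroup.zpowers x)
      (zpowersSMulAct x δ)) :
    crossedHom (g * h) = crossedHom g + ((g.right : Fˣ) : F) • crossedHom h := by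
  ext1
  · simp [crossedHom, toAdd_zpowersSMulAct]
  · simp [crossedHom]
    ring

theorem crossedHom_one :
    crossedHom (1 : SemidirectProduct (Multiplicative (Fin δ → F)) (Subgroup.zpowers x)
      (zpowersSMulAct x δ)) = 0 := by
  ext1 <;> simp [crossedHom]

variable (x) in
/-- The preimage of a subspace under `crossedHom` is a subgroup. -/
def crossedComap (T : Submodule F ((Fin δ → F) × F)) :
    Subgroup (SemidirectProduct (Multiplicative (Fin δ → F)) (Subgroup.zpowers x)
      (zpowersSMulAct x δ)) where
  carrier := {g | crossedHom g ∈ T}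
  one_mem' := by simp [crossedHom_one]
  mul_mem' {g h} hg hh := by
    simp only [Set.mem_ofPred_eq] at *
    rw [crossedHom_mul]
    exact T.add_mem hg (T.smul_mem _ hh)
  inv_mem' {g} hg := by
    simp only [Set.mem_ofPred_eq] at *
    have h := crossedHom_mul g g⁻¹
    rw [mul_inv_cancel, crossedHom_one, eq_comm, add_eq_zero_iff_eq_neg'] at h
    rw [← T.smul_mem_iff (Units.ne_zero (g.right : Fˣ)), h]
    exact T.neg_mem hg

theorem span_crossedHom_of_closure (hx : x ≠ 1)
    {S : Set (SemidirectProduct (Multiplicative (Fin δ → F)) (Subgroup.zpowers x)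
      (zpowersSMulAct x δ))}
    (hS : Subgroup.closure S = ⊤) : Submodule.span F (crossedHom '' S) = ⊤ := by
  set T := Submodule.span F (crossedHom '' S)
  have hT : ∀ g, crossedHom (x := x) g ∈ T := by
    intro g
    have hle : Subgroup.closure S ≤ crossedComap x T :=
      (Subgroup.closure_le _).2 fun s hs => Submodule.subset_span ⟨s, hs, rfl⟩
    exact hle (hS ▸ Subgroup.mem_top g)
  have hx' : (x : F) - 1 ≠ 0 := by
    rw [sub_ne_zero]
    exact fun h => hx (Units.ext h)
  rw [eq_top_iff]
  rintro ⟨v, a⟩ -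
  have h₁ := hT (SemidirectProduct.inl (Multiplicative.ofAdd v))
  have h₂ := hT (SemidirectProduct.inr ⟨x, Subgroup.mem_zpowers x⟩)
  convert T.add_mem h₁ (T.smul_mem (a / ((x : F) - 1)) h₂) using 1
  ext1
  · simp [crossedHom]
  · simp [crossedHom, hx']

/-- An additive subgroup stable under a generator of a finite field is stable under scalars. -/
theorem smul_mem_of_generator [Finite F] {M : Type*} [AddCommGroup M] [Module F M] {y : F}
    (hgen : ∀ K : Subfield F, y ∈ K → K = ⊤) (A : AddSubgroup M)
    (hA : ∀ v ∈ A, y • v ∈ A) (a : F) {v : M} (hv : v ∈ A) : a • v ∈ A := by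
  have := Fintype.ofFinite F
  let R : Subring F :=
    { carrier := {a | ∀ v ∈ A, a • v ∈ A}
      one_mem' := fun v hv => by simpa using hv
      zero_mem' := fun v hv => by simp
      mul_mem' := fun {a b} ha hb v hv => by
        rw [mul_smul]
        exact ha _ (hb _ hv)
      add_mem' := fun {a b} ha hb v hv => by
        rw [add_smul]
        exact A.add_mem (ha _ hv) (hb _ hv)
      neg_mem' := fun {a} ha v hv => by
        rw [neg_smul]
        exact A.neg_mem (ha _ hv) }
  let K : Subfield F :=
    { R with
      inv_mem' := fun a ha => by
        rcases eq_or_ne a 0 with rfl | h0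
        · simp
        · have hinv : a⁻¹ = a ^ (Fintype.card F - 2) := by
            refine inv_eq_of_mul_eq_one_right ?_
            rw [← pow_succ', ← FiniteField.pow_card_sub_one_eq_one a h0]
            congr 1
            have := Fintype.one_lt_card (α := F)
            omega
          rw [hinv]
          exact R.pow_mem ha _ }
  have hK : a ∈ K := hgen K hA ▸ Subfield.mem_top a
  exact hK v hv

theorem closure_of_span_crossedHom [Finite F] (hp : (orderOf x).Prime)
    (hgen : ∀ K : Subfield F, (x : F) ∈ K → K = ⊤)
    {S : Set (SemidirectProduct (Multiplicative (Fin δ → F)) (Subgroup.zpowers x)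
      (zpowersSMulAct x δ))}
    (hS : Submodule.span F (crossedHom '' S) = ⊤) : Subgroup.closure S = ⊤ := by
  set H := Subgroup.closure S
  have hcard : (Nat.card (Subgroup.zpowers x)).Prime := by rwa [Nat.card_zpowers]
  have hx : (x : F) - 1 ≠ 0 := by
    rw [sub_ne_zero]
    rintro h
    rw [Units.val_eq_one.1 h, orderOf_one] at hp
    exact Nat.not_prime_one hp
  -- `H` surjects onto `⟨x⟩`
  have hmap : H.map SemidirectProduct.rightHom = ⊤ := by
    have := Fact.mk hcard
    refine ((H.map SemidirectProduct.rightHom).eq_bot_or_eq_top_of_prime_card).resolve_left ?_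
    intro hbot
    have hle : Submodule.span F (crossedHom '' S) ≤
        LinearMap.ker (LinearMap.snd F (Fin δ → F) F) := by
      rw [Submodule.span_le]
      rintro _ ⟨s, hs, rfl⟩
      have hs' : SemidirectProduct.rightHom s ∈ H.map SemidirectProduct.rightHom :=
        Subgroup.mem_map_of_mem _ (Subgroup.subset_closure hs)
      rw [hbot, Subgroup.mem_bot, SemidirectProduct.rightHom_eq_right] at hs'
      simp [crossedHom, hs']
    have h1 : ((0, 1) : (Fin δ → F) × F) ∈ LinearMap.ker (LinearMap.snd F (Fin δ → F) F) :=
      hle (hS ▸ Submodule.mem_top)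
    simp at h1
  have hsurj : ∀ u : Subgroup.zpowers x, ∃ g ∈ H, g.right = u := by
    intro u
    have hu : u ∈ H.map SemidirectProduct.rightHom := hmap ▸ Subgroup.mem_top u
    simpa using hu
  obtain ⟨h, hhH, hh⟩ := hsurj ⟨x, Subgroup.mem_zpowers x⟩
  -- `H ∩ V` is a subspace
  let A : AddSubgroup (Fin δ → F) := Subgroup.toAddSubgroup' (H.comap SemidirectProduct.inl)
  have hA : ∀ v, v ∈ A ↔ SemidirectProduct.inl (Multiplicative.ofAdd v) ∈ H := fun v => Iff.rfl
  have hAx : ∀ v ∈ A, (x : F) • v ∈ A := by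
    intro v hv
    rw [hA] at hv ⊢
    convert H.mul_mem (H.mul_mem hhH hv) (H.inv_mem hhH) using 1
    apply SemidirectProduct.ext
    · simp only [SemidirectProduct.left_inl, SemidirectProduct.mul_left,
        SemidirectProduct.inv_left, SemidirectProduct.mul_right, SemidirectProduct.right_inl,
        mul_one, ← MulAut.mul_apply, ← map_mul, mul_inv_cancel, map_one, MulAut.one_apply]
      rw [mul_right_comm, mul_inv_cancel, one_mul, hh]
      rfl
    · simp
  let B : Submodule F (Fin δ → F) :=
    { A with smul_mem' := fun a _ hv => smul_mem_of_generator hgen A hAx a hv }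
  have hB : ∀ v, v ∈ B ↔ SemidirectProduct.inl (Multiplicative.ofAdd v) ∈ H := fun v => Iff.rfl
  have hright : ∀ g ∈ H, g.right = 1 → g.left.toAdd ∈ B := by
    intro g hg h1
    rw [hB]
    convert hg
    apply SemidirectProduct.ext <;> simp [h1]
  let T : Submodule F ((Fin δ → F) × F) := B.prod ⊥ ⊔ Submodule.span F {crossedHom h}
  have hhT : h ∈ crossedComap x T :=
    Submodule.mem_sup_right (Submodule.mem_span_singleton_self _)
  have hT : T = ⊤ := by
    rw [eq_top_iff, ← hS, Submodule.span_le]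
    rintro _ ⟨s, hs, rfl⟩
    obtain ⟨k, hk⟩ := Subgroup.mem_zpowers_iff.1 s.right.2
    have hk' : (h ^ k).right = s.right := by
      rw [← SemidirectProduct.rightHom_eq_right, map_zpow, SemidirectProduct.rightHom_eq_right, hh]
      exact Subtype.ext hk
    have h1 : (s * (h ^ k)⁻¹).right = 1 := by simp [hk']
    have hmem := hright _ (H.mul_mem (Subgroup.subset_closure hs)
      (H.inv_mem (H.zpow_mem hhH k))) h1
    have hmem' : s * (h ^ k)⁻¹ ∈ crossedComap x T :=
      Submodule.mem_sup_left ⟨hmem, by simp [crossedHom, hk']⟩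
    have := Subgroup.mul_mem _ hmem' (Subgroup.zpow_mem _ hhT k)
    rwa [inv_mul_cancel_right] at this
  have hBtop : ∀ v, v ∈ B := by
    intro v
    have hv : ((v, 0) : (Fin δ → F) × F) ∈ T := hT ▸ Submodule.mem_top
    obtain ⟨⟨w, b⟩, ⟨hw, hb⟩, z, hz, hwz⟩ := Submodule.mem_sup.1 hv
    obtain ⟨c, rfl⟩ := Submodule.mem_span_singleton.1 hz
    simp only [Submodule.mem_bot, SetLike.mem_coe] at hb hw
    subst hb
    have hc : c = 0 := by
      have := congrArg Prod.snd hwz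
      simpa [crossedHom, hh, hx] using this
    have := congrArg Prod.fst hwz
    simp only [hc, zero_smul, add_zero] at this
    rwa [← this]
  rw [eq_top_iff]
  rintro g -
  obtain ⟨g', hg', hr⟩ := hsurj g.right
  have hmem := (hB _).1 (hBtop (g * g'⁻¹).left.toAdd)
  have heq : g = SemidirectProduct.inl (Multiplicative.ofAdd (g * g'⁻¹).left.toAdd) * g' := by
    rw [← mul_inv_eq_iff_eq_mul]
    apply SemidirectProduct.ext
    · simp
    · simp [hr]
  rw [heq]
  exact H.mul_mem hmem hg'

end CrossedHom

theorem closure_image_ne_top_of_lt_minGen {G ι : Type*} [Group G] (f : ι → G) (s : Finset ι)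
    (hs : s.card < minGen G) : Subgroup.closure (f '' s) ≠ ⊤ := by
  classical
  intro h
  have : minGen G ≤ (s.image f).card := Nat.sInf_le ⟨s.image f, rfl, by simpa using h⟩
  have := Finset.card_image_le (s := s) (f := f)
  omega

theorem Function.range_update_eq_insert {ι α : Type*} [DecidableEq ι] (f : ι → α) (i : ι)
    (a : α) : Set.range (Function.update f i a) = insert a (f '' {i}ᶜ) := by
  ext b
  constructor
  · rintro ⟨j, rfl⟩
    rcases eq_or_ne j i with rfl | hj
    · simp
    · right
      exact ⟨j, hj, by simp [hj]⟩
  · rintro (rfl | ⟨j, hj, rfl⟩)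
    · exact ⟨i, by simp⟩
    · exact ⟨j, by rw [Function.update_of_ne hj]⟩

/-- Let `F` be a finite field, `x ∈ Fˣ` of prime order `p` generating `F` as a field
over its prime field. Then for every `δ ≥ 1` the semidirect product
`G = V^δ ⋊ ⟨x⟩`, with `x` acting on `V^δ = F^δ` by componentwise multiplication,
satisfies the MGSE property. -/
theorem mgse_of_semidirect_prime_order {F : Type*} [Field F] [Finite F]
    (p : ℕ) (hp : p.Prime) (x : Fˣ) (hx : orderOf x = p)
    (hgen : ∀ K : Subfield F, (x : F) ∈ K → K = ⊤)
    (δ : ℕ) (hδ : 1 ≤ δ) :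
    MGSE (SemidirectProduct (Multiplicative (Fin δ → F)) (Subgroup.zpowers x)
      (zpowersSMulAct x δ)) := by
  subst hx
  have hx1 : x ≠ 1 := by
    rintro rfl
    exact Nat.not_prime_one (orderOf_one (G := Fˣ) ▸ hp)
  intro f g hf hg i
  set W := Submodule.span F (crossedHom '' (f '' {i}ᶜ))
  have hWtop : W ≠ ⊤ := by
    intro h
    refine closure_image_ne_top_of_lt_minGen f {i}ᶜ ?_ (closure_of_span_crossedHom hp hgen ?_)
    · have := i.pos
      simp [Finset.card_compl]
      omega
    · simpa using h
  obtain ⟨j, hj⟩ : ∃ j, crossedHom (g j) ∉ W := by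
    by_contra! hcon
    refine hWtop (eq_top_iff.2 ?_)
    rw [← span_crossedHom_of_closure hx1 hg, Submodule.span_le]
    rintro _ ⟨_, ⟨j, rfl⟩, rfl⟩
    exact hcon j
  refine ⟨j, closure_of_span_crossedHom hp hgen ?_⟩
  have hspan := span_crossedHom_of_closure hx1 hf
  rw [← Function.update_eq_self i f, Function.range_update_eq_insert, Set.image_insert_eq]
    at hspan
  rw [Function.range_update_eq_insert, Set.image_insert_eq, eq_top_iff, ← hspan,
    Submodule.span_le]
  refine Set.insert_subset ?_ ((Set.subset_insert _ _).trans Submodule.subset_span)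
  exact mem_span_insert_exchange (hspan ▸ Submodule.mem_top) hj
end

section
/- Let G be a non-nilpotent finite group satisfying the MGSE property. Then G contains a unique maximal normal subgroup N (every proper normal subgroup of G is contained in N), and G/N is cyclic of order p for some prime p. In particular G is non-perfect and the abelianization G/[G,G] is a cyclic p-group. -/
section

open Matroid
open scoped commutatorElement

variable {G : Type*} [Group G]

theorem minGen_le_ncard [Finite G] {S : Set G} (hS : Subgroup.closure S = ⊤) :
    minGen G ≤ S.ncard := by
  refine Nat.sInf_le ⟨S.toFinite.toFinset, ?_, by simpa using hS⟩
  rw [Set.ncard_eq_toFinset_card S]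

theorem exists_ncard_eq_minGen (G : Type*) [Group G] [Finite G] :
    ∃ S : Set G, S.ncard = minGen G ∧ Subgroup.closure S = ⊤ := by
  have hne : {n | ∃ S : Finset G, S.card = n ∧ Subgroup.closure (S : Set G) = ⊤}.Nonempty :=
    ⟨_, Set.finite_univ.toFinset, rfl, by simp⟩
  obtain ⟨S, hcard, hS⟩ := Nat.sInf_mem hne
  exact ⟨S, by rw [Set.ncard_coe_finset]; exact hcard, hS⟩

/-- The generating sets of minimal size of a group with the MGSE property satisfy the basis
exchange axiom of matroids. -/
theorem MGSE.exchangeProperty [Finite G] (h : MGSE G) :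
    ExchangeProperty fun B : Set G ↦ B.ncard = minGen G ∧ Subgroup.closure B = ⊤ := by
  rintro X Y ⟨hX, hXtop⟩ ⟨hY, hYtop⟩ a ⟨haX, haY⟩
  have enum : ∀ S : Set G, S.ncard = minGen G →
      ∃ f : Fin (minGen G) → G, Function.Injective f ∧ Set.range f = S := by
    intro S hS
    let e := Finite.equivFinOfCardEq (α := S) hS
    exact ⟨fun i ↦ (e.symm i : G), Subtype.val_injective.comp e.symm.injective,
      by rw [show (fun i ↦ (e.symm i : G)) = Subtype.val ∘ e.symm from rfl,
        EquivLike.range_comp, Subtype.range_coe]⟩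
  obtain ⟨x, hxinj, rfl⟩ := enum X hX
  obtain ⟨y, -, rfl⟩ := enum Y hY
  obtain ⟨i, rfl⟩ := haX
  obtain ⟨j, hj⟩ := h x y hXtop hYtop i
  have hsub : Set.range (Function.update x i (y j)) ⊆ insert (y j) (Set.range x \ {x i}) := by
    rintro _ ⟨k, rfl⟩
    obtain rfl | hk := eq_or_ne k i
    · simp
    · rw [Function.update_of_ne hk]
      exact Or.inr ⟨⟨k, rfl⟩, fun hki ↦ hk (hxinj hki)⟩
  have htop : Subgroup.closure (insert (y j) (Set.range x \ {x i})) = ⊤ :=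
    top_le_iff.1 (hj ▸ Subgroup.closure_mono hsub)
  have hdiff : (Set.range x \ {x i}).ncard + 1 = minGen G := by
    rw [Set.ncard_sdiff_singleton_add_one (Set.mem_range_self i), hX]
  have hcard := minGen_le_ncard htop
  have hyj : y j ∉ Set.range x \ {x i} := fun hmem ↦ by
    rw [Set.insert_eq_of_mem hmem] at hcard
    omega
  refine ⟨y j, ⟨⟨j, rfl⟩, fun hmem ↦ hyj ⟨hmem, fun heq ↦ haY ⟨j, heq⟩⟩⟩, ?_, htop⟩
  rw [Set.ncard_insert_of_notMem hyj, hdiff]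

/-- The matroid on a group with the MGSE property whose bases are the generating sets of
minimal size. -/
def MGSE.matroid [Finite G] (h : MGSE G) : Matroid G :=
  Matroid.ofExistsFiniteIsBase Set.univ (fun B ↦ B.ncard = minGen G ∧ Subgroup.closure B = ⊤)
    ((exists_ncard_eq_minGen G).imp fun B hB ↦ ⟨hB, B.toFinite⟩) h.exchangeProperty
    fun _ _ ↦ Set.subset_univ _

namespace MGSE

variable [Finite G] (h : MGSE G)

theorem matroid_isBase_iff {B : Set G} :
    h.matroid.IsBase B ↔ B.ncard = minGen G ∧ Subgroup.closure B = ⊤ := Iff.rfl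

theorem mem_ground (x : G) : x ∈ h.matroid.E := Set.mem_univ x

theorem subset_ground (X : Set G) : X ⊆ h.matroid.E := Set.subset_univ X

variable {h} {I : Set G} {e x y : G}

theorem isBase_insert_of_closure_eq_top (he : e ∉ I) (hI : h.matroid.IsBase (insert e I))
    (hx : Subgroup.closure (insert x I) = ⊤) : x ∉ I ∧ h.matroid.IsBase (insert x I) := by
  have hcard := minGen_le_ncard hx
  have hcardI := ((matroid_isBase_iff h).1 hI).1
  rw [Set.ncard_insert_of_notMem he] at hcardI
  have hxI : x ∉ I := fun hmem ↦ by
    rw [Set.insert_eq_of_mem hmem] at hcard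
    omega
  exact ⟨hxI, by rw [Set.ncard_insert_of_notMem hxI, hcardI], hx⟩

/-- The hyperplane spanned by all but one element of a basis consists of the elements which
do not complete these to a generating set. -/
theorem mem_closure_iff_of_isBase_insert (he : e ∉ I) (hI : h.matroid.IsBase (insert e I)) :
    x ∈ h.matroid.closure I ↔ Subgroup.closure (insert x I) ≠ ⊤ := by
  have hind : h.matroid.Indep I := hI.indep.subset (Set.subset_insert _ _)
  rw [← not_iff_not, not_ne_iff, hind.notMem_closure_iff (mem_ground h x)]
  constructor
  · rintro ⟨hx, hxI⟩
    exact (insert_isBase_of_insert_indep he hxI hI hx).2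
  · intro hx
    obtain ⟨hxI, hbase⟩ := isBase_insert_of_closure_eq_top he hI hx
    exact ⟨hbase.indep, hxI⟩

theorem exists_isBase_of_notMem_loops (hx : x ∉ h.matroid.closure ∅) :
    ∃ J, x ∉ J ∧ h.matroid.IsBase (insert x J) := by
  have hind := ((h.matroid.empty_indep.notMem_closure_iff (mem_ground h x)).1 hx).1
  obtain ⟨B, hB, hxB⟩ := hind.exists_isBase_superset
  refine ⟨B \ {x}, by simp, ?_⟩
  rwa [Set.insert_sdiff_singleton, Set.insert_eq_of_mem (hxB (Set.mem_insert _ _))]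

theorem inv_mem_loops (hx : x ∈ h.matroid.closure ∅) : x⁻¹ ∈ h.matroid.closure ∅ := by
  by_contra hinv
  obtain ⟨J, hxJ, hJ⟩ := exists_isBase_of_notMem_loops hinv
  refine ((mem_closure_iff_of_isBase_insert hxJ hJ).1
    (h.matroid.closure_subset_closure (Set.empty_subset J) hx)) (top_le_iff.1 ?_)
  rw [← hJ.2, Subgroup.closure_le, Set.insert_subset_iff]
  exact ⟨inv_mem (Subgroup.subset_closure (Set.mem_insert _ _)),
    (Set.subset_insert _ _).trans Subgroup.subset_closure⟩

/-- A hyperplane containing a nonloop `x` is spanned by a set containing `x`. -/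
theorem exists_mem_isBase_insert (he : e ∉ I) (hI : h.matroid.IsBase (insert e I))
    (hx : x ∉ h.matroid.closure ∅) (hxI : x ∈ h.matroid.closure I) :
    ∃ J, x ∈ J ∧ e ∉ J ∧ h.matroid.IsBase (insert e J) ∧
      h.matroid.closure J = h.matroid.closure I := by
  have hIind : h.matroid.Indep I := hI.indep.subset (Set.subset_insert _ _)
  have hind : h.matroid.Indep {x} := by
    simpa using ((h.matroid.empty_indep.notMem_closure_iff (mem_ground h x)).1 hx).1
  obtain ⟨J, hJ, hxJ⟩ := hind.subset_isBasis_of_subset (Set.singleton_subset_iff.2 hxI)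
    (subset_ground h _)
  have hcl : h.matroid.closure J = h.matroid.closure I := by
    rw [hJ.closure_eq_closure, closure_closure]
  have heI : e ∉ h.matroid.closure I :=
    (hIind.notMem_closure_iff (mem_ground h e)).2 ⟨hI.indep, he⟩
  obtain ⟨heJ, heJ'⟩ := (hJ.indep.notMem_closure_iff (mem_ground h e)).1 (hcl ▸ heI)
  refine ⟨J, Set.singleton_subset_iff.1 hxJ, heJ', heJ.isBase_of_ground_subset_closure ?_, hcl⟩
  rw [← closure_insert_closure_eq_closure_insert, hcl, closure_insert_closure_eq_closure_insert,
    hI.closure_eq]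

theorem mul_mem_closure_of_notMem_loops_left (he : e ∉ I) (hI : h.matroid.IsBase (insert e I))
    (hx : x ∉ h.matroid.closure ∅) (hxI : x ∈ h.matroid.closure I)
    (hyI : y ∈ h.matroid.closure I) : x * y ∈ h.matroid.closure I := by
  obtain ⟨J, hxJ, heJ, hJ, hcl⟩ := exists_mem_isBase_insert he hI hx hxI
  rw [← hcl, mem_closure_iff_of_isBase_insert heJ hJ] at hyI ⊢
  contrapose! hyI
  rw [← top_le_iff, ← hyI, Subgroup.closure_le, Set.insert_subset_iff]
  exact ⟨mul_mem (Subgroup.subset_closure (Or.inr hxJ)) (Subgroup.subset_closure (Or.inl rfl)),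
    (Set.subset_insert _ _).trans Subgroup.subset_closure⟩

theorem mul_mem_closure_of_notMem_loops_right (he : e ∉ I) (hI : h.matroid.IsBase (insert e I))
    (hy : y ∉ h.matroid.closure ∅) (hxI : x ∈ h.matroid.closure I)
    (hyI : y ∈ h.matroid.closure I) : x * y ∈ h.matroid.closure I := by
  obtain ⟨J, hyJ, heJ, hJ, hcl⟩ := exists_mem_isBase_insert he hI hy hyI
  rw [← hcl, mem_closure_iff_of_isBase_insert heJ hJ] at hxI ⊢
  contrapose! hxI
  rw [← top_le_iff, ← hxI, Subgroup.closure_le, Set.insert_subset_iff]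
  exact ⟨mul_mem (Subgroup.subset_closure (Or.inl rfl)) (Subgroup.subset_closure (Or.inr hyJ)),
    (Set.subset_insert _ _).trans Subgroup.subset_closure⟩

theorem mul_mem_loops_of_indep_pair {l b c : G} (hl : l ∈ h.matroid.closure ∅)
    (hlc : l * c ∈ h.matroid.closure ∅) (hb : b ∉ h.matroid.closure ∅)
    (hcb : c ∉ h.matroid.closure {b}) : l * b ∈ h.matroid.closure ∅ := by
  have hbind : h.matroid.Indep {b} := by
    simpa using ((h.matroid.empty_indep.notMem_closure_iff (mem_ground h b)).1 hb).1
  obtain ⟨B, hB, hcbB⟩ :=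
    ((hbind.notMem_closure_iff (mem_ground h c)).1 hcb).1.exists_isBase_superset
  have hcB : c ∈ B := hcbB (Or.inl rfl)
  have hbB : b ∈ B \ {c} :=
    ⟨hcbB (Or.inr rfl), fun hbc ↦ hcb (by
      rw [← Set.mem_singleton_iff.1 hbc]
      exact h.matroid.mem_closure_of_mem rfl (subset_ground h _))⟩
  have hcI : c ∉ B \ {c} := by simp
  have hI : h.matroid.IsBase (insert c (B \ {c})) := by
    rwa [Set.insert_sdiff_singleton, Set.insert_eq_of_mem hcB]
  have loop_mem : ∀ {z}, z ∈ h.matroid.closure ∅ → z ∈ h.matroid.closure (B \ {c}) :=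
    fun hz ↦ h.matroid.closure_subset_closure (Set.empty_subset _) hz
  by_contra hlb
  have hlbI := mul_mem_closure_of_notMem_loops_right hcI hI hb (loop_mem hl)
    (h.matroid.mem_closure_of_mem hbB (subset_ground h _))
  have hprod := mul_mem_closure_of_notMem_loops_right hcI hI hlb
    (loop_mem (inv_mem_loops hlc)) hlbI
  refine (mem_closure_iff_of_isBase_insert hcI hI).1 hprod (top_le_iff.1 ?_)
  rw [← hI.2, Subgroup.closure_le, Set.insert_subset_iff]
  refine ⟨?_, (Set.subset_insert _ _).trans Subgroup.subset_closure⟩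
  have hmem := mul_mem
    (Subgroup.subset_closure (Set.mem_insert_of_mem ((l * c)⁻¹ * (l * b)) hbB))
    (inv_mem (Subgroup.subset_closure (Set.mem_insert ((l * c)⁻¹ * (l * b)) (B \ {c}))))
  have hc : b * ((l * c)⁻¹ * (l * b))⁻¹ = c := by group
  rwa [hc] at hmem

/-- If some nonloop is carried to a loop by left multiplication with the loop `l`, then so are
all nonloops. -/
theorem mul_mem_loops_of_exists (hG : ∀ g : G, Subgroup.closure {g} ≠ ⊤) {l b c : G}
    (hl : l ∈ h.matroid.closure ∅) (hc : c ∉ h.matroid.closure ∅)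
    (hlc : l * c ∈ h.matroid.closure ∅) (hb : b ∉ h.matroid.closure ∅) :
    l * b ∈ h.matroid.closure ∅ := by
  by_cases hcb : c ∉ h.matroid.closure {b}
  · exact mul_mem_loops_of_indep_pair hl hlc hb hcb
  rw [not_not] at hcb
  obtain ⟨J, hcJ, hJ⟩ := exists_isBase_of_notMem_loops hc
  obtain ⟨a, haJ⟩ : J.Nonempty := by
    by_contra hJe
    rw [Set.not_nonempty_iff_eq_empty] at hJe
    subst hJe
    exact hG c (by simpa using hJ.2)
  have hca : c ∉ h.matroid.closure {a} := fun hmem ↦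
    ((hJ.indep.subset (Set.subset_insert _ _)).notMem_closure_iff (mem_ground h c)).2
      ⟨hJ.indep, hcJ⟩ (h.matroid.closure_subset_closure (Set.singleton_subset_iff.2 haJ) hmem)
  have ha : a ∉ h.matroid.closure ∅ := by
    have := hJ.indep.notMem_closure_sdiff_of_mem (Or.inr haJ)
    exact fun hmem ↦ this (h.matroid.closure_subset_closure (Set.empty_subset _) hmem)
  refine mul_mem_loops_of_indep_pair hl (mul_mem_loops_of_indep_pair hl hlc ha hca) hb
    fun hab ↦ hca ?_
  have hba : b ∈ h.matroid.closure {a} := by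
    simpa using (h.matroid.closure_exchange (X := ∅) (e := a) (f := b) (by simpa using ⟨hab, ha⟩)).1
  exact h.matroid.closure_subset_closure_of_subset_closure (Set.singleton_subset_iff.2 hba) hcb

theorem mul_mem_loops (hG : ∀ g : G, Subgroup.closure {g} ≠ ⊤)
    (hx : x ∈ h.matroid.closure ∅) (hy : y ∈ h.matroid.closure ∅) :
    x * y ∈ h.matroid.closure ∅ := by
  by_contra hxy
  have key : ∀ g : G, x⁻¹ * g ∈ h.matroid.closure ∅ ∧
      ∀ b ∉ h.matroid.closure ∅, x⁻¹ * g * b ∈ h.matroid.closure ∅ := by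
    intro g
    obtain ⟨B, hB⟩ := h.matroid.exists_isBase
    have hstep : ∀ g b : G, b ∉ h.matroid.closure ∅ →
        (x⁻¹ * g ∈ h.matroid.closure ∅ ∧
          ∀ b ∉ h.matroid.closure ∅, x⁻¹ * g * b ∈ h.matroid.closure ∅) →
        x⁻¹ * (g * b) ∈ h.matroid.closure ∅ ∧
          ∀ c ∉ h.matroid.closure ∅, x⁻¹ * (g * b) * c ∈ h.matroid.closure ∅ := by
      rintro g b hb ⟨hg, hmul⟩
      have hgb : x⁻¹ * (g * b) ∈ h.matroid.closure ∅ := by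
        rw [← mul_assoc]
        exact hmul b hb
      refine ⟨hgb, fun c hc ↦ mul_mem_loops_of_exists hG hgb (c := b⁻¹)
        (fun hinv ↦ hb (by simpa using inv_mem_loops hinv)) ?_ hc⟩
      simpa [mul_assoc] using hg
    have hnonloop : ∀ b ∈ B, b ∉ h.matroid.closure ∅ := fun b hb hmem ↦
      hB.indep.notMem_closure_sdiff_of_mem hb
        (h.matroid.closure_subset_closure (Set.empty_subset _) hmem)
    refine Subgroup.closure_induction_right (s := B)
      (p := fun g _ ↦ x⁻¹ * g ∈ h.matroid.closure ∅ ∧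
        ∀ b ∉ h.matroid.closure ∅, x⁻¹ * g * b ∈ h.matroid.closure ∅) ?_ ?_ ?_
      (x := g) (hB.2 ▸ Subgroup.mem_top g)
    · refine ⟨by simpa using inv_mem_loops hx, fun b hb ↦ ?_⟩
      rw [mul_one]
      exact mul_mem_loops_of_exists hG (inv_mem_loops hx) hxy (by simpa using hy) hb
    · exact fun g _ b hb hg ↦ hstep g b (hnonloop b hb) hg
    · exact fun g _ b hb hg ↦ hstep g b⁻¹
        (fun hinv ↦ hnonloop b hb (by simpa using inv_mem_loops hinv)) hg
  simpa using hxy (by simpa using (key x).2 _ hxy)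

/-- In a noncyclic group with the MGSE property, the hyperplanes of the matroid of minimal
generating sets are maximal subgroups. -/
theorem exists_isCoatom_coe_eq_closure (hG : ∀ g : G, Subgroup.closure {g} ≠ ⊤)
    (he : e ∉ I) (hI : h.matroid.IsBase (insert e I)) :
    ∃ H : Subgroup G, IsCoatom H ∧ (H : Set G) = h.matroid.closure I := by
  let H : Subgroup G :=
    { carrier := h.matroid.closure I
      one_mem' := by
        rw [mem_closure_iff_of_isBase_insert he hI]
        intro htop
        refine (isBase_insert_of_closure_eq_top he hI (x := 1) htop).2.indep
          |>.notMem_closure_sdiff_of_mem (Or.inl rfl) ?_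
        have hone : (1 : G) ∈ h.matroid.closure ∅ := by
          by_contra hone
          obtain ⟨J, hJ1, hJ⟩ := exists_isBase_of_notMem_loops hone
          have hlt := minGen_le_ncard (S := J) (by simpa using hJ.2)
          have := hJ.1
          rw [Set.ncard_insert_of_notMem hJ1] at this
          omega
        exact h.matroid.closure_subset_closure (Set.empty_subset _) hone
      mul_mem' := by
        intro x y hx hy
        by_cases hxl : x ∈ h.matroid.closure ∅
        · by_cases hyl : y ∈ h.matroid.closure ∅
          · exact h.matroid.closure_subset_closure (Set.empty_subset _) (mul_mem_loops hG hxl hyl)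
          · exact mul_mem_closure_of_notMem_loops_right he hI hyl hx hy
        · exact mul_mem_closure_of_notMem_loops_left he hI hxl hx hy
      inv_mem' := by
        intro x hx
        rw [mem_closure_iff_of_isBase_insert he hI] at hx ⊢
        contrapose! hx
        rw [← top_le_iff, ← hx, Subgroup.closure_le, Set.insert_subset_iff]
        exact ⟨inv_mem (Subgroup.subset_closure (Or.inl rfl)),
          (Set.subset_insert _ _).trans Subgroup.subset_closure⟩ }
  have hmem : ∀ x, x ∈ H ↔ Subgroup.closure (insert x I) ≠ ⊤ :=
    fun x ↦ mem_closure_iff_of_isBase_insert he hI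
  refine ⟨H, ⟨fun htop ↦ (hmem e).1 (htop ▸ Subgroup.mem_top e) hI.2, fun K hK ↦ ?_⟩, rfl⟩
  obtain ⟨g, hgK, hgH⟩ := SetLike.exists_of_lt hK
  rw [hmem, not_ne_iff] at hgH
  rw [← top_le_iff, ← hgH, Subgroup.closure_le, Set.insert_subset_iff]
  exact ⟨hgK, fun y hy ↦ hK.le (h.matroid.mem_closure_of_mem hy (subset_ground h _))⟩

end MGSE

/-- The intersection of the maximal subgroups containing a given set. -/
def maximalClosure (X : Set G) : Subgroup G :=
  sInf {M | IsCoatom M ∧ X ⊆ M}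

theorem mem_maximalClosure {X : Set G} {g : G} :
    g ∈ maximalClosure X ↔ ∀ M : Subgroup G, IsCoatom M → X ⊆ M → g ∈ M := by
  simp [maximalClosure, Subgroup.mem_sInf]

theorem MGSE.coe_maximalClosure [Finite G] (h : MGSE G)
    (hG : ∀ g : G, Subgroup.closure {g} ≠ ⊤) (X : Set G) :
    (maximalClosure X : Set G) = h.matroid.closure X := by
  ext g
  rw [SetLike.mem_coe, mem_maximalClosure]
  constructor
  · intro hg
    by_contra hgX
    obtain ⟨I, hI⟩ := h.matroid.exists_isBasis X (subset_ground h X)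
    rw [← hI.closure_eq_closure, hI.indep.notMem_closure_iff (mem_ground h g)] at hgX
    obtain ⟨B, hB, hgB⟩ := hgX.1.exists_isBase_superset
    have hB' : h.matroid.IsBase (insert g (B \ {g})) := by
      rwa [Set.insert_sdiff_singleton, Set.insert_eq_of_mem (hgB (Or.inl rfl))]
    have hgB' : g ∉ B \ {g} := by simp
    obtain ⟨H, hH, hHeq⟩ := exists_isCoatom_coe_eq_closure hG hgB' hB'
    have hIB : I ⊆ B \ {g} := fun i hi ↦ ⟨hgB (Or.inr hi), fun hig ↦ hgX.2 (hig ▸ hi)⟩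
    have hXH : X ⊆ H := by
      rw [hHeq]
      exact hI.subset_closure.trans (h.matroid.closure_subset_closure hIB)
    have hgH : g ∈ (H : Set G) := hg H hH hXH
    rw [hHeq] at hgH
    exact hB.indep.notMem_closure_sdiff_of_mem (hgB (Or.inl rfl)) hgH
  · intro hg M hM hXM
    obtain ⟨I, hI⟩ := h.matroid.exists_isBasis (M : Set G) (subset_ground h _)
    obtain ⟨B, hB, hIB⟩ := hI.indep.exists_isBase_superset
    obtain ⟨b, hbB, hbM⟩ : ∃ b ∈ B, b ∉ M := by
      by_contra! hall
      exact hM.1 (top_le_iff.1 (hB.2 ▸ (Subgroup.closure_le M).2 hall))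
    have hB' : h.matroid.IsBase (insert b (B \ {b})) := by
      rwa [Set.insert_sdiff_singleton, Set.insert_eq_of_mem hbB]
    have hbB' : b ∉ B \ {b} := by simp
    obtain ⟨H, hH, hHeq⟩ := exists_isCoatom_coe_eq_closure hG hbB' hB'
    have hIB' : I ⊆ B \ {b} := fun i hi ↦ ⟨hIB hi, fun hib ↦ hbM (hib ▸ hI.subset hi)⟩
    have hMH : h.matroid.closure M ⊆ H := by
      rw [hHeq, ← hI.closure_eq_closure]
      exact h.matroid.closure_subset_closure hIB'
    have hle : M ≤ H := fun m hm ↦ hMH (h.matroid.mem_closure_of_mem hm (subset_ground h _))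
    have hMeq : M = H := (hM.le_iff.1 hle).resolve_left hH.1 |>.symm
    rw [hMeq]
    exact hMH (h.matroid.closure_subset_closure hXM hg)

/-- The exchange property for intersections of maximal subgroups. -/
def MaximalClosureExchange (G : Type*) [Group G] : Prop :=
  ∀ (X : Set G) (x y : G), y ∈ maximalClosure (insert x X) → y ∉ maximalClosure X →
    x ∈ maximalClosure (insert y X)

theorem MGSE.maximalClosureExchange [Finite G] (h : MGSE G)
    (hG : ∀ g : G, Subgroup.closure {g} ≠ ⊤) : MaximalClosureExchange G := by
  intro X x y hy hyX
  rw [← SetLike.mem_coe, h.coe_maximalClosure hG] at hy hyX ⊢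
  exact (Matroid.closure_exchange ⟨hy, hyX⟩).1

section MaximalClosure

theorem subset_maximalClosure (X : Set G) : X ⊆ maximalClosure X :=
  fun _ hx ↦ mem_maximalClosure.2 fun _ _ hM ↦ hM hx

theorem maximalClosure_le {X : Set G} {M : Subgroup G} (hM : IsCoatom M) (hX : X ⊆ M) :
    maximalClosure X ≤ M :=
  fun _ hx ↦ mem_maximalClosure.1 hx M hM hX

theorem maximalClosure_le_maximalClosure {X Y : Set G} (h : X ⊆ maximalClosure Y) :
    maximalClosure X ≤ maximalClosure Y :=
  fun _ hx ↦ mem_maximalClosure.2 fun M hM hYM ↦ mem_maximalClosure.1 hx M hM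
    (h.trans (maximalClosure_le hM hYM))

theorem conj_mem_maximalClosure {X Y : Set G} {x : G} (g : G) (hx : x ∈ maximalClosure X)
    (hXY : ∀ a ∈ X, g * a * g⁻¹ ∈ maximalClosure Y) : g * x * g⁻¹ ∈ maximalClosure Y := by
  refine mem_maximalClosure.2 fun M hM hYM ↦ ?_
  have hM' : IsCoatom ((MulAut.conj g).comapSubgroup M) :=
    ((MulAut.conj g).comapSubgroup.isCoatom_iff M).2 hM
  exact mem_maximalClosure.1 hx _ hM' fun a ha ↦ maximalClosure_le hM hYM (hXY a ha)

theorem maximalClosure_normal (F : Set G) (hF : ∀ g : G, ∀ a ∈ F, g * a * g⁻¹ ∈ F) :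
    (maximalClosure F).Normal :=
  ⟨fun _ hn g ↦ conj_mem_maximalClosure g hn fun a ha ↦ subset_maximalClosure F (hF g a ha)⟩

variable {F : Subgroup G} {x y z : G}

theorem le_maximalClosure_insert : F ≤ maximalClosure (insert x (F : Set G)) :=
  fun _ hf ↦ subset_maximalClosure _ (Or.inr hf)

theorem self_mem_maximalClosure_insert {X : Set G} : x ∈ maximalClosure (insert x X) :=
  subset_maximalClosure _ (Or.inl rfl)

theorem conj_mem_maximalClosure_insert [F.Normal] (g : G)
    (hy : y ∈ maximalClosure (insert x (F : Set G))) :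
    g * y * g⁻¹ ∈ maximalClosure (insert (g * x * g⁻¹) (F : Set G)) := by
  refine conj_mem_maximalClosure g hy ?_
  rintro a (rfl | ha)
  · exact self_mem_maximalClosure_insert
  · exact le_maximalClosure_insert (Subgroup.Normal.conj_mem ‹_› a ha g)

theorem MaximalClosureExchange.maximalClosure_insert_eq (hE : MaximalClosureExchange G)
    (hF : maximalClosure F = F) (hy : y ∈ maximalClosure (insert x (F : Set G))) (hyF : y ∉ F) :
    maximalClosure (insert y (F : Set G)) = maximalClosure (insert x (F : Set G)) := by
  refine le_antisymm (maximalClosure_le_maximalClosure ?_) (maximalClosure_le_maximalClosure ?_)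
  · exact Set.insert_subset hy fun _ hf ↦ le_maximalClosure_insert hf
  · exact Set.insert_subset (hE _ _ _ hy (by rwa [hF])) fun _ hf ↦ le_maximalClosure_insert hf

theorem conj_notMem [hn : F.Normal] (hx : x ∉ F) (g : G) : g * x * g⁻¹ ∉ F :=
  fun h ↦ hx (by simpa [mul_assoc] using hn.mem_comm h)

theorem MaximalClosureExchange.mem_normalizer [F.Normal] (hE : MaximalClosureExchange G)
    (hF : maximalClosure F = F) (hx : x ∉ F)
    (hz : z * x * z⁻¹ ∈ maximalClosure (insert x (F : Set G))) :
    z ∈ Subgroup.normalizer (maximalClosure (insert x (F : Set G)) : Set G) := by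
  have heq := hE.maximalClosure_insert_eq hF hz (conj_notMem hx z)
  rw [Subgroup.mem_normalizer_iff]
  refine fun a ↦ ⟨fun ha ↦ heq ▸ conj_mem_maximalClosure_insert z ha, fun ha ↦ ?_⟩
  rw [← heq] at ha
  simpa [mul_assoc] using conj_mem_maximalClosure_insert z⁻¹ ha

/-- If the closure of a normal closed subgroup and one element is not self-normalizing, then it
is normal. -/
theorem MaximalClosureExchange.normalizer_eq_top [Finite G] [F.Normal]
    (hE : MaximalClosureExchange G) (hF : maximalClosure F = F) (hx : x ∉ F)
    (hne : Subgroup.normalizer (maximalClosure (insert x (F : Set G)) : Set G) ≠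
      maximalClosure (insert x (F : Set G))) :
    Subgroup.normalizer (maximalClosure (insert x (F : Set G)) : Set G) = ⊤ := by
  set P := maximalClosure (insert x (F : Set G))
  by_contra htop
  obtain ⟨H, hH, hPH⟩ :=
    (eq_top_or_exists_le_coatom (Subgroup.normalizer (P : Set G))).resolve_left htop
  obtain ⟨n, hn, hnP⟩ := SetLike.exists_of_lt (lt_of_le_of_ne Subgroup.le_normalizer hne.symm)
  have hPle : (P : Set G) ⊆ H := fun a ha ↦ hPH (Subgroup.le_normalizer ha)
  have hPP : maximalClosure (P : Set G) = P :=
    le_antisymm (maximalClosure_le_maximalClosure subset_rfl) (subset_maximalClosure _)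
  obtain ⟨z, hz⟩ : ∃ z, z ∉ H := by
    by_contra! hall
    exact hH.1 (top_le_iff.1 fun g _ ↦ hall g)
  have hxP : x ∈ P := self_mem_maximalClosure_insert
  have conj_mem : ∀ w, ∀ a ∈ P, w * a * w⁻¹ ∈ maximalClosure (insert w (P : Set G)) :=
    fun w a ha ↦ mul_mem (mul_mem self_mem_maximalClosure_insert (le_maximalClosure_insert ha))
      (inv_mem self_mem_maximalClosure_insert)
  have hyP : z * x * z⁻¹ ∉ P := fun hy ↦ hz (hPH (hE.mem_normalizer hF hx hy))
  have hzmem : z ∈ maximalClosure (insert (z * x * z⁻¹) (P : Set G)) :=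
    hE _ _ _ (conj_mem z x hxP) (by rwa [hPP])
  have hyH : z * x * z⁻¹ ∉ H := fun hy ↦
    hz (maximalClosure_le hH (Set.insert_subset hy hPle) hzmem)
  have hznmem : z * n ∈ maximalClosure (insert (z * x * z⁻¹) (P : Set G)) := by
    refine hE _ _ _ ?_ (by rwa [hPP])
    have := conj_mem (z * n) (n⁻¹ * x * n) (by
      simpa using (Subgroup.mem_normalizer_iff.1 (inv_mem hn) x).1 hxP)
    simpa [mul_assoc] using this
  have hnmem : n ∈ maximalClosure (insert (z * x * z⁻¹) (P : Set G)) := by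
    simpa using mul_mem (inv_mem hzmem) hznmem
  exact hyH (maximalClosure_le hH (Set.insert_subset (hPH hn) hPle)
    (hE _ _ _ hnmem (by rwa [hPP])))

/-- Elements whose closure is self-normalizing avoid all proper normal subgroups. -/
theorem MaximalClosureExchange.notMem_of_normalizer_eq [Finite G] [F.Normal]
    (hE : MaximalClosureExchange G) (hF : maximalClosure F = F) (hFM : ∀ H, IsCoatom H → F ≤ H)
    (hx : x ∉ F)
    (hself : Subgroup.normalizer (maximalClosure (insert x (F : Set G)) : Set G) =
      maximalClosure (insert x (F : Set G)))
    {M : Subgroup G} (hM : M.Normal) (hMtop : M ≠ ⊤) : x ∉ M := by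
  intro hxM
  obtain ⟨H, hH, hMH⟩ := (eq_top_or_exists_le_coatom M).resolve_left hMtop
  set P := maximalClosure (insert x (F : Set G))
  have hPH : P ≤ H := maximalClosure_le hH (Set.insert_subset (hMH hxM) (hFM H hH))
  have hPP : maximalClosure (P : Set G) = P :=
    le_antisymm (maximalClosure_le_maximalClosure subset_rfl) (subset_maximalClosure _)
  refine hH.1 (top_le_iff.1 fun z _ ↦ by_contra fun hz ↦ ?_)
  by_cases hy : z * x * z⁻¹ ∈ P
  · exact hz (hPH (hself ▸ hE.mem_normalizer hF hx hy))
  · refine hz (maximalClosure_le hH (Set.insert_subset (hMH (hM.conj_mem x hxM z)) hPH)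
      (hE _ _ _ ?_ (by rwa [hPP])))
    exact mul_mem (mul_mem self_mem_maximalClosure_insert
      (le_maximalClosure_insert self_mem_maximalClosure_insert))
      (inv_mem self_mem_maximalClosure_insert)

theorem MaximalClosureExchange.commutatorElement_mem (hE : MaximalClosureExchange G)
    (hF : maximalClosure F = F)
    (hx : (maximalClosure (insert x (F : Set G))).Normal)
    (hy : (maximalClosure (insert y (F : Set G))).Normal)
    (hxy : maximalClosure (insert x (F : Set G)) ≠ maximalClosure (insert y (F : Set G))) :
    ⁅x, y⁆ ∈ F := by
  have hmem := Subgroup.commutator_le_inf _ _ (Subgroup.commutator_mem_commutator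
    (self_mem_maximalClosure_insert (x := x) (X := (F : Set G)))
    (self_mem_maximalClosure_insert (x := y) (X := (F : Set G))))
  by_contra hnot
  exact hxy ((hE.maximalClosure_insert_eq hF hmem.1 hnot).symm.trans
    (hE.maximalClosure_insert_eq hF hmem.2 hnot))

theorem maximalClosure_insert_of_mem (hF : maximalClosure F = F) (hx : x ∈ F) :
    maximalClosure (insert x (F : Set G)) = F := by
  rw [Set.insert_eq_of_mem hx, hF]

theorem MaximalClosureExchange.exists_not_normal [Finite G] [hFn : F.Normal]
    (hE : MaximalClosureExchange G) (hF : maximalClosure F = F) (hFM : ∀ H, IsCoatom H → F ≤ H)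
    (hG : ∀ g : G, Subgroup.closure {g} ≠ ⊤) (hnil : ¬ Group.IsNilpotent G) :
    ∃ x ∉ F, ¬ (maximalClosure (insert x (F : Set G))).Normal := by
  by_contra! hall
  have hnorm : ∀ x, (maximalClosure (insert x (F : Set G))).Normal := fun x ↦ by
    by_cases hx : x ∈ F
    · rwa [maximalClosure_insert_of_mem hF hx]
    · exact hall x hx
  have hcomm : ∀ x y : G, ⁅x, y⁆ ∈ F := by
    intro x y
    by_cases hxy : maximalClosure (insert x (F : Set G)) = maximalClosure (insert y (F : Set G))
    swap
    · exact hE.commutatorElement_mem hF (hnorm x) (hnorm y) hxy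
    obtain ⟨H, hH, hxH⟩ := (eq_top_or_exists_le_coatom (Subgroup.closure {x})).resolve_left (hG x)
    have hle : maximalClosure (insert x (F : Set G)) ≤ H :=
      maximalClosure_le hH (Set.insert_subset (hxH (Subgroup.subset_closure rfl)) (hFM H hH))
    obtain ⟨z, hz⟩ : ∃ z, z ∉ H := by
      by_contra! hall
      exact hH.1 (top_le_iff.1 fun g _ ↦ hall g)
    have hyx : y ∈ maximalClosure (insert x (F : Set G)) :=
      hxy ▸ self_mem_maximalClosure_insert
    have hxw : ∀ w ∉ H, ⁅x, w⁆ ∈ F := fun w hw ↦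
      hE.commutatorElement_mem hF (hnorm x) (hnorm w) fun heq ↦
        hw (hle (heq ▸ self_mem_maximalClosure_insert))
    have hzy := hxw (z * y) fun hmem ↦ hz ((H.mul_mem_cancel_right (hle hyx)).1 hmem)
    have := hFn.conj_mem _ (mul_mem (inv_mem (hxw z hz)) hzy) z⁻¹
    simpa [commutatorElement_def, mul_assoc] using this
  have htfae : Group.IsNilpotent G ↔ ∀ H : Subgroup G, IsCoatom H → H.Normal :=
    Group.isNilpotent_of_finite_tfae.out 0 2
  refine hnil (htfae.2 fun H hH ↦ ⟨fun n hn g ↦ ?_⟩)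
  have := H.mul_mem (hFM H hH (hcomm g n)) hn
  simpa [commutatorElement_def, mul_assoc] using this

theorem MaximalClosureExchange.sup_ne_top [Finite G] [hFn : F.Normal]
    (hE : MaximalClosureExchange G) (hF : maximalClosure F = F) (hFM : ∀ H, IsCoatom H → F ≤ H)
    (hG : ∀ g : G, Subgroup.closure {g} ≠ ⊤) (hnil : ¬ Group.IsNilpotent G)
    {M N : Subgroup G} (hM : M.Normal) (hN : N.Normal) (hMtop : M ≠ ⊤) (hNtop : N ≠ ⊤) :
    M ⊔ N ≠ ⊤ := by
  intro htop
  obtain ⟨q, hqF, hq⟩ := hE.exists_not_normal hF hFM hG hnil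
  have hnorm : ∀ (K : Subgroup G), K.Normal → K ≠ ⊤ → ∀ x ∈ K,
      (maximalClosure (insert x (F : Set G))).Normal := by
    intro K hK hKtop x hxK
    by_cases hx : x ∈ F
    · rwa [maximalClosure_insert_of_mem hF hx]
    · exact Subgroup.normalizer_eq_top_iff.1 (hE.normalizer_eq_top hF hx fun hself ↦
        hE.notMem_of_normalizer_eq hF hFM hx hself hK hKtop hxK)
  obtain ⟨x, hx, y, hy, rfl⟩ := Subgroup.mem_sup_of_normal_left.1 (htop ▸ Subgroup.mem_top q)
  have hxn := hnorm M hM hMtop x hx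
  have hyn := hnorm N hN hNtop y hy
  by_cases hxF : x ∈ F
  · have : x * y ∈ maximalClosure (insert y (F : Set G)) :=
      mul_mem (le_maximalClosure_insert hxF) self_mem_maximalClosure_insert
    exact hq (hE.maximalClosure_insert_eq hF this hqF ▸ hyn)
  by_cases hxy : maximalClosure (insert x (F : Set G)) = maximalClosure (insert y (F : Set G))
  · have : x * y ∈ maximalClosure (insert x (F : Set G)) :=
      mul_mem self_mem_maximalClosure_insert (hxy ▸ self_mem_maximalClosure_insert)
    exact hq (hE.maximalClosure_insert_eq hF this hqF ▸ hxn)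
  have hself : Subgroup.normalizer (maximalClosure (insert (x * y) (F : Set G)) : Set G) =
      maximalClosure (insert (x * y) (F : Set G)) := by
    by_contra hne
    exact hq (Subgroup.normalizer_eq_top_iff.1 (hE.normalizer_eq_top hF hqF hne))
  have hxq : x ∈ maximalClosure (insert (x * y) (F : Set G)) := by
    rw [← hself]
    refine hE.mem_normalizer hF hqF ?_
    have h1 := hFn.conj_mem _ (hE.commutatorElement_mem hF hxn hyn hxy) x
    have h2 := mul_mem (le_maximalClosure_insert (x := x * y) h1)
      (self_mem_maximalClosure_insert (x := x * y) (X := (F : Set G)))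
    simpa [commutatorElement_def, mul_assoc] using h2
  exact hq (hE.maximalClosure_insert_eq hF hxq hxF ▸ hxn)

end MaximalClosure

/-- If every element outside `N` fixes exactly one point, every element of `N` fixes every point
and every point is fixed by an element outside `N`, then there is at most one point. -/
theorem subsingleton_of_existsUnique_smul_eq [Finite G] {Ω : Type*} [Finite Ω] [MulAction G Ω]
    (N : Subgroup G) (hN : ∀ g ∈ N, ∀ ω : Ω, g • ω = ω) (hΩ : ∀ ω : Ω, ∃ g ∉ N, g • ω = ω)
    (huniq : ∀ g ∉ N, ∃! ω : Ω, g • ω = ω) : Subsingleton Ω := by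
  classical
  have := Fintype.ofFinite G
  have := Fintype.ofFinite Ω
  choose c hcN hc using hΩ
  have hle : Fintype.card Ω * Fintype.card N ≤ Fintype.card {g // g ∉ N} := by
    rw [← Fintype.card_prod]
    refine Fintype.card_le_of_injective (fun a : Ω × N ↦ (⟨c a.1 * a.2, fun h ↦
      hcN a.1 ((N.mul_mem_cancel_right a.2.2).1 h)⟩ : {g // g ∉ N})) ?_
    rintro ⟨ω, n⟩ ⟨ω', n'⟩ heq
    have heq' : c ω * n = c ω' * n' := congrArg Subtype.val heq
    obtain rfl : ω = ω' := by
      refine (huniq (c ω * n) fun h ↦ hcN ω ((N.mul_mem_cancel_right n.2).1 h)).unique ?_ ?_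
      · rw [mul_smul, hN _ n.2, hc]
      · rw [heq', mul_smul, hN _ n'.2, hc]
    simpa using heq'
  have hburnside := MulAction.sum_card_fixedBy_eq_card_orbits_mul_card_group G Ω
  have hsum : ∑ g : G, Fintype.card (MulAction.fixedBy Ω g) =
      Fintype.card N * Fintype.card Ω + Fintype.card {g // g ∉ N} := by
    rw [← Fintype.sum_subtype_add_sum_subtype (· ∈ N)]
    congr 1
    · rw [Finset.sum_congr rfl (g := fun _ ↦ Fintype.card Ω), Finset.sum_const]
      · simp
      · rintro ⟨g, hg⟩ -
        exact Fintype.card_congr (Equiv.subtypeUnivEquiv fun ω ↦ hN g hg ω)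
    · rw [Finset.sum_congr rfl (g := fun _ ↦ 1), Finset.sum_const]
      · simp
      · rintro ⟨g, hg⟩ -
        obtain ⟨ω, hω, hω'⟩ := huniq g hg
        exact Fintype.card_eq_one_iff.2 ⟨⟨ω, hω⟩, fun a ↦ Subtype.ext (hω' a a.2)⟩
  have hcard : Fintype.card G = Fintype.card N + Fintype.card {g // g ∉ N} := by
    rw [Fintype.card_subtype_compl]
    have := Fintype.card_subtype_le (· ∈ N)
    omega
  have hpos : 0 < Fintype.card N := Fintype.card_pos
  rw [hsum] at hburnside
  rw [← Fintype.card_le_one_iff_subsingleton]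
  have hk : Fintype.card (Quotient (MulAction.orbitRel G Ω)) ≤ 1 := by
    by_contra! hk
    nlinarith
  by_contra! hcardΩ
  nlinarith

theorem MaximalClosureExchange.isCoatom_of_forall_normal_le [Finite G] {N : Subgroup G}
    [hN : N.Normal] (hE : MaximalClosureExchange G) (hcl : maximalClosure N = N) (hNtop : N ≠ ⊤)
    (hmax : ∀ M : Subgroup G, M.Normal → M ≠ ⊤ → M ≤ N) : IsCoatom N := by
  obtain ⟨H, hH, hNH⟩ := (eq_top_or_exists_le_coatom N).resolve_left hNtop
  suffices H ≤ N by rwa [le_antisymm hNH this]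
  by_contra hHN
  obtain ⟨x, hxH, hxN⟩ := SetLike.not_le_iff_exists.1 hHN
  have hxle : maximalClosure (insert x (N : Set G)) ≤ H :=
    maximalClosure_le hH (Set.insert_subset hxH hNH)
  have hself : ∀ w ∉ N, Subgroup.normalizer (maximalClosure (insert w (N : Set G)) : Set G) =
      maximalClosure (insert w (N : Set G)) := by
    intro w hw
    by_contra hne
    have hnorm := Subgroup.normalizer_eq_top_iff.1 (hE.normalizer_eq_top hcl hw hne)
    by_cases htop : maximalClosure (insert w (N : Set G)) = ⊤
    · have heq := hE.maximalClosure_insert_eq hcl (htop ▸ Subgroup.mem_top x) hxN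
      exact hH.1 (top_le_iff.1 (htop ▸ heq ▸ hxle))
    · exact hw (hmax _ hnorm htop self_mem_maximalClosure_insert)
  let Ω := {P : Subgroup G // ∃ w ∉ N, P = maximalClosure (insert w (N : Set G))}
  let : MulAction G Ω :=
    { smul g P := ⟨P.1.map (MulAut.conj g).toMonoidHom, by
        obtain ⟨w, hw, hP⟩ := P.2
        refine ⟨g * w * g⁻¹, conj_notMem hw g, le_antisymm ?_ fun a ha ↦ ?_⟩
        · rw [hP, Subgroup.map_le_iff_le_comap]
          exact fun a ha ↦ conj_mem_maximalClosure_insert g ha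
        · refine ⟨g⁻¹ * a * g, ?_, by simp [mul_assoc]⟩
          rw [hP]
          simpa [mul_assoc] using conj_mem_maximalClosure_insert g⁻¹ ha⟩
      one_smul P := Subtype.ext (by
        change P.1.map (MulAut.conj 1).toMonoidHom = P.1
        ext
        simp [Subgroup.mem_map])
      mul_smul g g' P := Subtype.ext (by
        change P.1.map (MulAut.conj (g * g')).toMonoidHom =
          (P.1.map (MulAut.conj g').toMonoidHom).map (MulAut.conj g).toMonoidHom
        rw [Subgroup.map_map, map_mul]
        rfl) }
  have hfix : ∀ (g : G) (P : Ω), g • P = P ↔ g ∈ P.1 := by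
    rintro g ⟨P, w, hw, rfl⟩
    have hmem := Subgroup.mem_normalizer_iff_map_conj_eq
      (H := maximalClosure (insert w (N : Set G))) (g := g)
    rw [hself w hw] at hmem
    exact Subtype.ext_iff.trans hmem.symm
  have hsub : Subsingleton Ω := by
    refine subsingleton_of_existsUnique_smul_eq N ?_ ?_ ?_
    · rintro g hg ⟨P, w, hw, rfl⟩
      exact (hfix _ _).2 (le_maximalClosure_insert hg)
    · rintro ⟨P, w, hw, rfl⟩
      exact ⟨w, hw, (hfix _ _).2 self_mem_maximalClosure_insert⟩
    · refine fun g hg ↦ ⟨⟨_, g, hg, rfl⟩, (hfix _ _).2 self_mem_maximalClosure_insert, ?_⟩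
      rintro ⟨P, w, hw, rfl⟩ hP
      exact Subtype.ext (hE.maximalClosure_insert_eq hcl ((hfix _ _).1 hP) hg).symm
  refine hH.1 (top_le_iff.1 fun g _ ↦ ?_)
  by_cases hg : g ∈ N
  · exact hNH hg
  · have heq : (⟨_, g, hg, rfl⟩ : Ω) = ⟨_, x, hxN, rfl⟩ := Subsingleton.elim _ _
    exact hxle ((congrArg Subtype.val heq).le self_mem_maximalClosure_insert)

/-- A normal subgroup which is a maximal subgroup has prime index. -/
theorem IsCoatom.prime_card_quotient [Finite G] {N : Subgroup G} [N.Normal] (hN : IsCoatom N) :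
    (Nat.card (G ⧸ N)).Prime := by
  have hne : Nat.card (G ⧸ N) ≠ 1 := fun h ↦ hN.1 (Subgroup.index_eq_one.1 h)
  obtain ⟨p, hp, hdvd⟩ := Nat.exists_prime_and_dvd hne
  have := Fact.mk hp
  obtain ⟨q, hq⟩ := exists_prime_orderOf_dvd_card' p hdvd
  have hle : N ≤ (Subgroup.zpowers q).comap (QuotientGroup.mk' N) := fun n hn ↦ by
    rw [Subgroup.mem_comap, QuotientGroup.mk'_apply, (QuotientGroup.eq_one_iff n).2 hn]
    exact one_mem _
  have htop : Subgroup.zpowers q = ⊤ := by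
    rcases hN.le_iff.1 hle with h | h
    · exact Subgroup.comap_injective (QuotientGroup.mk'_surjective N) (h.trans (by simp))
    · obtain ⟨x, rfl⟩ := QuotientGroup.mk'_surjective N q
      have hx : x ∈ N := h ▸ Subgroup.mem_zpowers _
      rw [QuotientGroup.mk'_apply, (QuotientGroup.eq_one_iff x).2 hx, orderOf_one] at hq
      exact absurd hq hp.ne_one.symm
  rwa [← Subgroup.card_top, ← htop, Nat.card_zpowers, hq]

theorem zpowers_abelianization_of_eq_top {N : Subgroup G}
    (hmax : ∀ M : Subgroup G, M.Normal → M ≠ ⊤ → M ≤ N) {x : G} (hx : x ∉ N) :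
    Subgroup.zpowers (Abelianization.of x) = ⊤ := by
  by_contra hne
  refine hx (hmax ((Subgroup.zpowers (Abelianization.of x)).comap Abelianization.of)
    inferInstance (fun htop ↦ hne ?_) (Subgroup.mem_zpowers _))
  exact Subgroup.comap_injective (QuotientGroup.mk'_surjective (commutator G))
    (htop.trans (Subgroup.comap_top _).symm)

theorem MGSE.exists_normal_isCoatom [Finite G] (hnil : ¬ Group.IsNilpotent G) (h : MGSE G) :
    ∃ N : Subgroup G, N.Normal ∧ IsCoatom N ∧ ∀ M : Subgroup G, M.Normal → M ≠ ⊤ → M ≤ N := by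
  have hG : ∀ g : G, Subgroup.closure {g} ≠ ⊤ := fun g hg ↦ hnil <| by
    rw [← Subgroup.zpowers_eq_closure] at hg
    have : IsCyclic G := ⟨g, fun x ↦ hg.ge (Subgroup.mem_top x)⟩
    let := IsCyclic.commGroup (α := G)
    exact CommGroup.isNilpotent
  have hE := h.maximalClosureExchange hG
  have := maximalClosure_normal (∅ : Set G) (by simp)
  have hcl : maximalClosure (maximalClosure (∅ : Set G) : Set G) = maximalClosure ∅ :=
    le_antisymm (maximalClosure_le_maximalClosure subset_rfl) (subset_maximalClosure _)
  have hle : ∀ H : Subgroup G, IsCoatom H → maximalClosure ∅ ≤ H :=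
    fun H hH ↦ maximalClosure_le hH (Set.empty_subset _)
  have hbot : (⊥ : Subgroup G) ≠ ⊤ := fun hbot ↦ hG 1 (by rw [Subgroup.closure_singleton_one, hbot])
  obtain ⟨N, ⟨hN, hNtop⟩, hNmax⟩ :=
    (Set.toFinite {M : Subgroup G | M.Normal ∧ M ≠ ⊤}).exists_maximal ⟨⊥, inferInstance, hbot⟩
  have hmax : ∀ M : Subgroup G, M.Normal → M ≠ ⊤ → M ≤ N := fun M hM hMtop ↦
    le_sup_left.trans (hNmax (y := M ⊔ N) ⟨inferInstance,
      hE.sup_ne_top hcl hle hG hnil hM hN hMtop hNtop⟩ le_sup_right)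
  refine ⟨N, hN, hE.isCoatom_of_forall_normal_le ?_ hNtop hmax, hmax⟩
  refine le_antisymm (hmax _ (maximalClosure_normal _ fun g a ha ↦ hN.conj_mem a ha g) ?_)
    (subset_maximalClosure _)
  obtain ⟨H, hH, hNH⟩ := (eq_top_or_exists_le_coatom N).resolve_left hNtop
  exact fun htop ↦ hH.1 (top_le_iff.1 (htop ▸ maximalClosure_le hH hNH))

end

/-- If a non-nilpotent finite group `G` satisfies the MGSE property, then `G` has a
unique maximal normal subgroup `N` (containing every proper normal subgroup), and the
quotient `G/N` is cyclic of prime order `p`; in particular `G` is non-perfect and its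
abelianization is a cyclic `p`-group. -/
theorem mgse_unique_maximal_normal {G : Type*} [Group G] [Finite G]
    (hnil : ¬ Group.IsNilpotent G) (h : MGSE G) :
    ∃ (N : Subgroup G) (hN : N.Normal) (p : ℕ), N ≠ ⊤ ∧
      (∀ M : Subgroup G, M.Normal → M ≠ ⊤ → M ≤ N) ∧
      p.Prime ∧
      (haveI := hN; IsCyclic (G ⧸ N)) ∧ Nat.card (G ⧸ N) = p ∧
      commutator G ≠ ⊤ ∧
      IsCyclic (Abelianization G) ∧ IsPGroup p (Abelianization G) := by
  obtain ⟨N, hN, hcoatom, hmax⟩ := h.exists_normal_isCoatom hnil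
  have hp := hcoatom.prime_card_quotient
  have hp' := Fact.mk hp
  have hcyc : IsCyclic (G ⧸ N) := isCyclic_of_prime_card rfl
  have hcomm : commutator G ≤ N := by
    let := IsCyclic.commGroup (α := G ⧸ N)
    simpa using Abelianization.commutator_subset_ker (QuotientGroup.mk' N)
  obtain ⟨x, hx⟩ : ∃ x, x ∉ N := by
    by_contra! hall
    exact hcoatom.1 (top_le_iff.1 fun g _ ↦ hall g)
  refine ⟨N, hN, _, hcoatom.1, hmax, hp, hcyc, rfl,
    fun htop ↦ hcoatom.1 (top_le_iff.1 (htop ▸ hcomm)), ?_, ?_⟩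
  · exact ⟨Abelianization.of x, fun y ↦
      (zpowers_abelianization_of_eq_top hmax hx).ge (Subgroup.mem_top y)⟩
  · obtain ⟨k, m, hm, hcard⟩ := Nat.exists_eq_pow_mul_and_not_dvd
      (Nat.card_pos (α := Abelianization G)).ne' (Nat.card (G ⧸ N)) hp.ne_one
    have hxm : x ^ m ∉ N := fun hmem ↦ hm <| by
      rw [← QuotientGroup.eq_one_iff, QuotientGroup.mk_pow] at hmem
      have hdvd := orderOf_dvd_of_pow_eq_one hmem
      rwa [orderOf_eq_prime (pow_card_eq_one')
        fun hone ↦ hx ((QuotientGroup.eq_one_iff x).1 hone)] at hdvd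
    have htop := zpowers_abelianization_of_eq_top hmax hxm
    have hpow : Abelianization.of (x ^ m) ^ Nat.card (G ⧸ N) ^ k = 1 := by
      rw [map_pow, ← pow_mul, mul_comm, ← hcard, pow_card_eq_one']
    refine fun a ↦ ⟨k, ?_⟩
    obtain ⟨i, rfl⟩ := Subgroup.mem_zpowers_iff.1 (htop ▸ Subgroup.mem_top a)
    rw [← zpow_natCast, zpow_comm, zpow_natCast, hpow, one_zpow]
end

section
/- Let x = (2,3,4,5) and y = (1,2,3,5,4) be permutations of {1,2,3,4,5}, and let G be the subgroup of the symmetric group on 5 points generated by x and y. Then the sets {x², x·y} and {x, y} both generate G, but both ⟨x², x⟩ and ⟨x², y⟩ are proper subgroups of G; hence the generating sets {x², x·y} and {x, y} fail the exchange property and G does not satisfy the MGSE property (even though d(G) = 2). -/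
open Subgroup in
/-- A set of elements of a subgroup `G` generates `G` internally iff it does so in the ambient
group. -/
theorem closure_eq_top_iff_closure_image_val {A : Type*} [Group A] {G : Subgroup A} (S : Set G) :
    closure S = ⊤ ↔ closure (Subtype.val '' S) = G := by
  rw [← (map_injective G.subtype_injective).eq_iff, MonoidHom.map_closure,
    ← MonoidHom.range_eq_map, range_subtype]
  rfl

open Subgroup in
theorem two_le_card_of_closure_eq_top {A : Type*} [Group A] {a b : A} (hab : a * b ≠ b * a)
    {S : Finset A} (hS : closure (S : Set A) = ⊤) : 2 ≤ S.card := by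
  by_contra! h
  obtain ⟨g, hg⟩ : ∃ g, (S : Set A) ⊆ {g} := by
    rcases Finset.card_le_one_iff_subset_singleton.mp (Nat.le_of_lt_succ h) with ⟨g, hg⟩
    exact ⟨g, by exact_mod_cast hg⟩
  have mem_zpowers (c : A) : c ∈ zpowers g := by
    rw [zpowers_eq_closure]
    exact closure_mono hg (hS ▸ mem_top c)
  obtain ⟨m, rfl⟩ := mem_zpowers a
  obtain ⟨n, rfl⟩ := mem_zpowers b
  exact hab ((Commute.refl g).zpow_zpow m n)

open Subgroup in
theorem minGen_eq_two {A : Type*} [Group A] {a b : A} (hab : a * b ≠ b * a)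
    (hgen : closure {a, b} = ⊤) : minGen A = 2 := by
  classical
  have hne : a ≠ b := by
    rintro rfl
    exact hab rfl
  have hmem : 2 ∈ {n | ∃ S : Finset A, S.card = n ∧ closure (S : Set A) = ⊤} :=
    ⟨{a, b}, Finset.card_pair hne, by simpa using hgen⟩
  refine le_antisymm (Nat.sInf_le hmem) (le_csInf ⟨2, hmem⟩ ?_)
  rintro _ ⟨S, rfl, hS⟩
  exact two_le_card_of_closure_eq_top hab hS

open Subgroup in
theorem MGSE.exchange_of_minGen_eq_two {A : Type*} [Group A] (hA : MGSE A) (hd : minGen A = 2)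
    {a b c d : A} (hab : closure {a, b} = ⊤) (hcd : closure {c, d} = ⊤) :
    closure {a, c} = ⊤ ∨ closure {a, d} = ⊤ := by
  unfold MGSE at hA
  rw [hd] at hA
  obtain ⟨j, hj⟩ := hA ![a, b] ![c, d] (by simpa [Set.pair_comm] using hab)
    (by simpa [Set.pair_comm] using hcd) 1
  have range_update (e : A) : Set.range (Function.update ![a, b] 1 e) = {a, e} := by
    ext g
    simp [Fin.exists_fin_two, eq_comm]
  rw [range_update] at hj
  fin_cases j
  · exact Or.inl hj
  · exact Or.inr hj

open Subgroup in
/-- If `y = (x * y)⁻² * x²`, then `{x², x * y}` generates `⟨x, y⟩`; if moreover neither `x` nor `y`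
can replace `x * y` in it, then `⟨x, y⟩` does not have the exchange property. -/
theorem not_mgse_closure_pair {A : Type*} [Group A] {x y : A}
    (hword : ((x * y) ^ 2)⁻¹ * x ^ 2 = y) (hcomm : x * y ≠ y * x)
    (hy_notMem : y ∉ closure {x ^ 2, x}) (hx_notMem : x ∉ closure {x ^ 2, y}) :
    closure {x ^ 2, x * y} = closure {x, y} ∧
    closure {x ^ 2, x} < closure {x, y} ∧
    closure {x ^ 2, y} < closure {x, y} ∧
    minGen (closure {x, y}) = 2 ∧
    ¬ MGSE (closure {x, y}) := by
  have hx : x ∈ closure {x, y} := subset_closure (by simp)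
  have hy : y ∈ closure {x, y} := subset_closure (by simp)
  have hgen : closure {x ^ 2, x * y} = closure {x, y} := by
    refine le_antisymm ?_ ?_
    · rw [closure_le, Set.pair_subset_iff]
      exact ⟨pow_mem hx 2, mul_mem hx hy⟩
    · have hs : x ^ 2 ∈ closure {x ^ 2, x * y} := subset_closure (by simp)
      have ht : x * y ∈ closure {x ^ 2, x * y} := subset_closure (by simp)
      have hy' : y ∈ closure {x ^ 2, x * y} := by
        have := mul_mem (inv_mem (pow_mem ht 2)) hs
        rwa [hword] at this
      rw [closure_le, Set.pair_subset_iff]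
      exact ⟨(mul_mem_cancel_right hy').mp ht, hy'⟩
  have hlt_x : closure {x ^ 2, x} < closure {x, y} := by
    refine lt_of_le_of_ne ?_ fun h => hy_notMem (h ▸ hy)
    rw [closure_le, Set.pair_subset_iff]
    exact ⟨pow_mem hx 2, hx⟩
  have hlt_y : closure {x ^ 2, y} < closure {x, y} := by
    refine lt_of_le_of_ne ?_ fun h => hx_notMem (h ▸ hx)
    rw [closure_le, Set.pair_subset_iff]
    exact ⟨pow_mem hx 2, hy⟩
  have pair_generates_iff (a b : closure {x, y}) :
      closure {a, b} = ⊤ ↔ closure {(a : A), ↑b} = closure {x, y} := by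
    rw [closure_eq_top_iff_closure_image_val, Set.image_pair]
  let x' : closure {x, y} := ⟨x, hx⟩
  let y' : closure {x, y} := ⟨y, hy⟩
  have hgen_xy : closure {x', y'} = ⊤ := (pair_generates_iff x' y').mpr rfl
  have hd : minGen (closure {x, y}) = 2 :=
    minGen_eq_two (fun h => hcomm (congrArg Subtype.val h)) hgen_xy
  refine ⟨hgen, hlt_x, hlt_y, hd, fun hG => ?_⟩
  have hgen' : closure {x' ^ 2, x' * y'} = ⊤ := by
    rw [pair_generates_iff, coe_pow, coe_mul]
    exact hgen
  rcases hG.exchange_of_minGen_eq_two hd hgen' hgen_xy with h | h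
  · rw [pair_generates_iff, coe_pow] at h
    exact hlt_x.ne h
  · rw [pair_generates_iff, coe_pow] at h
    exact hlt_y.ne h

/-- Let `x = (2,3,4,5)` and `y = (1,2,3,5,4)` (written 0-based on `Fin 5` as
`c[1,2,3,4]` and `c[0,1,2,4,3]`) and let `G = ⟨x, y⟩ ≤ Sym(5)`. Then `{x², x·y}`
and `{x, y}` both generate `G`, but `⟨x², x⟩` and `⟨x², y⟩` are proper subgroups of
`G`; hence these two generating sets fail the exchange property and `G` does not
satisfy the MGSE property, even though `d(G) = 2`. -/
theorem perm5_example_fails_mgse :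
    let x : Equiv.Perm (Fin 5) := c[1, 2, 3, 4]
    let y : Equiv.Perm (Fin 5) := c[0, 1, 2, 4, 3]
    let G : Subgroup (Equiv.Perm (Fin 5)) := Subgroup.closure {x, y}
    Subgroup.closure {x ^ 2, x * y} = G ∧
    Subgroup.closure {x, y} = G ∧
    Subgroup.closure {x ^ 2, x} < G ∧
    Subgroup.closure {x ^ 2, y} < G ∧
    minGen G = 2 ∧
    ¬ MGSE G := by
  intro x y G
  have hword : ((x * y) ^ 2)⁻¹ * x ^ 2 = y := by decide +kernel
  have hcomm : x * y ≠ y * x := by decide +kernel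
  have hy_notMem : y ∉ Subgroup.closure {x ^ 2, x} := by
    intro hmem
    have hfix : x ∈ MulAction.stabilizer (Equiv.Perm (Fin 5)) (0 : Fin 5) :=
      show x 0 = 0 by decide
    have hle : Subgroup.closure {x ^ 2, x} ≤
        MulAction.stabilizer (Equiv.Perm (Fin 5)) (0 : Fin 5) := by
      rw [Subgroup.closure_le, Set.pair_subset_iff]
      exact ⟨pow_mem hfix 2, hfix⟩
    have hy0 : y 0 = 0 := hle hmem
    exact absurd hy0 (by decide)
  have hx_notMem : x ∉ Subgroup.closure {x ^ 2, y} := by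
    intro hmem
    have hle : Subgroup.closure {x ^ 2, y} ≤ alternatingGroup (Fin 5) := by
      rw [Subgroup.closure_le, Set.pair_subset_iff]
      exact ⟨Equiv.Perm.mem_alternatingGroup.mpr (by decide +kernel),
        Equiv.Perm.mem_alternatingGroup.mpr (by decide +kernel)⟩
    have hsign := Equiv.Perm.mem_alternatingGroup.mp (hle hmem)
    exact absurd hsign (by decide +kernel)
  obtain ⟨hgen, hlt_x, hlt_y, hd, hG⟩ := not_mgse_closure_pair hword hcomm hy_notMem hx_notMem
  exact ⟨hgen, rfl, hlt_x, hlt_y, hd, hG⟩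
end
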